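/- arXiv:1106.2058 — 3 statements merged into one kernel-verified Lean document; each statement's English description precedes it below -/
import Mathlib

section
/- The number of urn configurations ψ : [2m] → [n] whose type vector is (d_1, ..., d_k, 2m − Σ_{i≤k} d_i) (the last entry being the count of a single 'grey' color) and whose induced multigraph restricted to [k] has adjacency matrix A ∈ A_k equals m! · 2^{m − m_g − Σ_i A(i,i)/2} / ((∏_{i≤j≤k} A*(i,j)!) · (∏_{i=1}^k (d_i − d(A,i))!) · m_g!), where A*(i,j) = A(i,j) for i < j, A*(i,i) = A(i,i)/2, m_{[k]} = (1/2)Σ_{i,j≤k} A(i,j), d_{[k]} = Σ_{i=1}^k d_i, and m_g = m − d_{[k]} + m_{[k]}. -/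
open Finset Nat

/-- The number of balls of color `i` in the urn configuration `ψ`. -/
def colorCount {M n : ℕ} (ψ : Fin M → Fin n) (i : Fin n) : ℕ :=
  (Finset.univ.filter fun l => ψ l = i).card

/-- The adjacency matrix obtained from the urn configuration `ψ : [2m] → [n]` by the
stub-pairing map: the balls at positions `2e−1` and `2e` are the endpoints of edge `e`. -/
def stubAdj {m n : ℕ} (ψ : Fin (2 * m) → Fin n) (i j : Fin n) : ℕ :=
  ∑ e : Fin m,
    ((if ψ ⟨2 * (e : ℕ), by have := e.isLt; omega⟩ = i ∧
         ψ ⟨2 * (e : ℕ) + 1, by have := e.isLt; omega⟩ = j then 1 else 0) +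
     (if ψ ⟨2 * (e : ℕ), by have := e.isLt; omega⟩ = j ∧
         ψ ⟨2 * (e : ℕ) + 1, by have := e.isLt; omega⟩ = i then 1 else 0))

/-- `A*(i,j)`: equal to `A(i,j)` off the diagonal and to `A(i,i)/2` (the number of loops)
on the diagonal. -/
def Astar {k : ℕ} (A : Fin k → Fin k → ℕ) (i j : Fin k) : ℕ :=
  if i = j then A i i / 2 else A i j

/-- The degree `d(A,i) = ∑_j A(i,j)`. -/
def degA {k : ℕ} (A : Fin k → Fin k → ℕ) (i : Fin k) : ℕ := ∑ j, A i j

/-- The endpoints of a pair, in increasing order. -/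
def sortPair {α : Type*} [LinearOrder α] (p : α × α) : α × α := (min p.1 p.2, max p.1 p.2)

/-- The number of edges in a list of ordered edges whose sorted pair of endpoints is `p`. -/
def edgeCount {α : Type*} [LinearOrder α] {m : ℕ} (w : Fin m → α × α) (p : α × α) : ℕ :=
  (Finset.univ.filter fun e => sortPair (w e) = p).card

/-- Cutting a sequence of length `2 * m` into `m` consecutive pairs. -/
def stubEquiv (m : ℕ) (α : Type*) : (Fin (2 * m) → α) ≃ (Fin m → α × α) where
  toFun ψ e := (ψ ⟨2 * (e : ℕ), by have := e.isLt; omega⟩,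
    ψ ⟨2 * (e : ℕ) + 1, by have := e.isLt; omega⟩)
  invFun w l :=
    if (l : ℕ) % 2 = 0 then (w ⟨(l : ℕ) / 2, by have := l.isLt; omega⟩).1
    else (w ⟨(l : ℕ) / 2, by have := l.isLt; omega⟩).2
  left_inv ψ := by
    funext l
    dsimp only
    split_ifs with h <;> congr 1 <;> ext <;> dsimp only <;> omega
  right_inv w := by
    funext e
    have h1 : (2 * (e : ℕ)) / 2 = e := by omega
    have h2 : (2 * (e : ℕ) + 1) / 2 = e := by omega
    have h3 : (2 * (e : ℕ) + 1) % 2 = 1 := by omega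
    simp [h2, h3]

theorem sum_fin_two_mul {m : ℕ} (f : Fin (2 * m) → ℕ) :
    ∑ l, f l = ∑ e : Fin m, (f ⟨2 * (e : ℕ), by have := e.isLt; omega⟩ +
      f ⟨2 * (e : ℕ) + 1, by have := e.isLt; omega⟩) := by
  rw [← Equiv.sum_comp (finProdFinEquiv.trans (finCongr (Nat.mul_comm m 2))) f,
    Fintype.sum_prod_type]
  refine Finset.sum_congr rfl fun e _ => ?_
  rw [Fin.sum_univ_two]
  congr 2 <;> ext <;> simp [Nat.add_comm]

theorem colorCount_eq_sum_stubAdj {m n : ℕ} (ψ : Fin (2 * m) → Fin n) (i : Fin n) :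
    colorCount ψ i = ∑ j, stubAdj ψ i j := by
  unfold colorCount stubAdj
  rw [Finset.card_filter, sum_fin_two_mul, Finset.sum_comm]
  refine Finset.sum_congr rfl fun e _ => ?_
  simp [Finset.sum_add_distrib, ite_and]

theorem stubAdj_comm {m n : ℕ} (ψ : Fin (2 * m) → Fin n) (i j : Fin n) :
    stubAdj ψ i j = stubAdj ψ j i :=
  Finset.sum_congr rfl fun _ _ => Nat.add_comm _ _

theorem stubAdj_self {m n : ℕ} (ψ : Fin (2 * m) → Fin n) (i : Fin n) :
    stubAdj ψ i i = 2 * edgeCount (stubEquiv m _ ψ) (i, i) := by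
  unfold stubAdj edgeCount
  rw [Finset.card_filter, Finset.mul_sum]
  refine Finset.sum_congr rfl fun e _ => ?_
  simp only [sortPair, stubEquiv, Equiv.coe_fn_mk, Prod.mk.injEq]
  grind

theorem stubAdj_of_lt {m n : ℕ} (ψ : Fin (2 * m) → Fin n) {i j : Fin n} (h : i < j) :
    stubAdj ψ i j = edgeCount (stubEquiv m _ ψ) (i, j) := by
  unfold stubAdj edgeCount
  rw [Finset.card_filter]
  refine Finset.sum_congr rfl fun e _ => ?_
  simp only [sortPair, stubEquiv, Equiv.coe_fn_mk, Prod.mk.injEq]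
  grind

theorem edgeCount_of_lt {α : Type*} [LinearOrder α] {m : ℕ} (w : Fin m → α × α) {i j : α}
    (h : j < i) : edgeCount w (i, j) = 0 := by
  rw [edgeCount, Finset.card_eq_zero, Finset.filter_eq_empty_iff]
  intro e _
  simp only [sortPair, Prod.mk.injEq]
  grind

theorem sum_edgeCount {α : Type*} [LinearOrder α] [Fintype α] {m : ℕ} (w : Fin m → α × α) :
    ∑ p, edgeCount w p = m := by
  have := Finset.card_eq_sum_card_fiberwise (s := Finset.univ) (t := Finset.univ)
    (f := fun e => sortPair (w e)) (by simp)
  simpa [edgeCount] using this.symm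

theorem card_sortPair_fiber {α : Type*} [LinearOrder α] [Fintype α] {i j : α} (h : i ≤ j) :
    (Finset.univ.filter fun p : α × α => sortPair p = (i, j)).card = if i = j then 1 else 2 := by
  have : (Finset.univ.filter fun p : α × α => sortPair p = (i, j)) = {(i, j), (j, i)} := by
    ext ⟨a, b⟩
    simp only [sortPair, Finset.mem_filter, Finset.mem_univ, true_and, Prod.mk.injEq,
      Finset.mem_insert, Finset.mem_singleton]
    grind
  rw [this]
  split_ifs with hij
  · simp [hij]
  · exact Finset.card_pair (by simp [hij])

/-- Words of length `m` over `β` with prescribed numbers `N a` of letters in each fibre of `g`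
are counted by a multinomial coefficient times the numbers of choices inside the fibres. -/
theorem card_filter_fiber_counts {α β : Type*} [Fintype α] [DecidableEq α] [Fintype β]
    (g : β → α) (m : ℕ) (N : α → ℕ) (hN : ∑ a, N a = m) :
    (Finset.univ.filter fun w : Fin m → β =>
        ∀ a, (Finset.univ.filter fun e => g (w e) = a).card = N a).card =
      Nat.multinomial Finset.univ N *
        ∏ a, (Finset.univ.filter fun b => g b = a).card ^ N a := by
  have monomial_prod (c : α → ℕ) (n : α → ℕ) :
      ∏ a, ((c a : MvPolynomial α ℕ) * MvPolynomial.X a) ^ n a =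
        MvPolynomial.monomial (Finsupp.equivFunOnFinite.symm n) (∏ a, c a ^ n a) := by
    rw [MvPolynomial.monomial_eq, Finsupp.prod_fintype _ _ (by simp)]
    simp [mul_pow, Finset.prod_mul_distrib]
  have key : (∑ b, MvPolynomial.X (g b) : MvPolynomial α ℕ) ^ m =
      (∑ a, ((Finset.univ.filter fun b => g b = a).card : MvPolynomial α ℕ) *
        MvPolynomial.X a) ^ m := by
    rw [← Finset.sum_fiberwise Finset.univ g]
    congr 1
    refine Finset.sum_congr rfl fun a _ => ?_
    rw [Finset.sum_congr rfl (g := fun _ => MvPolynomial.X a)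
      (fun b hb => by rw [(Finset.mem_filter.1 hb).2])]
    simp
  rw [Fintype.sum_pow, Finset.sum_pow_eq_sum_piAntidiag] at key
  have hprod (w : Fin m → β) : ∏ e, (MvPolynomial.X (g (w e)) : MvPolynomial α ℕ) =
      MvPolynomial.monomial (Finsupp.equivFunOnFinite.symm
        fun a => (Finset.univ.filter fun e => g (w e) = a).card) 1 := by
    have := monomial_prod 1 fun a => (Finset.univ.filter fun e => g (w e) = a).card
    simp only [Pi.one_apply, Nat.cast_one, one_mul, one_pow, Finset.prod_const_one] at this
    rw [← this, Finset.prod_comp (fun a => (MvPolynomial.X a : MvPolynomial α ℕ))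
      (fun e => g (w e))]
    refine Finset.prod_subset (Finset.subset_univ _) fun a _ ha => ?_
    rw [Finset.card_eq_zero.2, pow_zero]
    rw [Finset.filter_eq_empty_iff]
    exact fun e _ h => ha (Finset.mem_image.2 ⟨e, Finset.mem_univ _, h⟩)
  simp only [hprod, monomial_prod] at key
  have := congrArg (MvPolynomial.coeff (Finsupp.equivFunOnFinite.symm N)) key
  simp only [MvPolynomial.coeff_sum, MvPolynomial.coeff_monomial, EmbeddingLike.apply_eq_iff_eq,
    ← map_natCast (MvPolynomial.C (R := ℕ) (σ := α)), MvPolynomial.coeff_C_mul] at this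
  rw [Finset.card_filter]
  simp only [funext_iff] at this
  rw [this, Finset.sum_eq_single N]
  · simp
  · intro n _ hn
    rw [if_neg fun h => hn (funext h), mul_zero]
  · intro h
    simp [hN] at h

/-- The number of edges with endpoints `p.1 ≤ p.2` prescribed by the corner `A` and the degrees
`d`, the last color being grey with `mg` internal edges. -/
def cornerCount {k : ℕ} (d : Fin k → ℕ) (A : Fin k → Fin k → ℕ) (mg : ℕ)
    (p : Fin (k + 1) × Fin (k + 1)) : ℕ :=
  Fin.lastCases (motive := fun _ => ℕ)
    (Fin.lastCases (motive := fun _ => ℕ) mg (fun _ => 0) p.2)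
    (fun i => Fin.lastCases (motive := fun _ => ℕ) (d i - degA A i)
      (fun j => if i ≤ j then Astar A i j else 0) p.2) p.1

section cornerCount

variable {k : ℕ} (d : Fin k → ℕ) (A : Fin k → Fin k → ℕ) (mg : ℕ)

@[simp] theorem cornerCount_castSucc_castSucc (i j : Fin k) :
    cornerCount d A mg (i.castSucc, j.castSucc) = if i ≤ j then Astar A i j else 0 := by
  simp [cornerCount]

@[simp] theorem cornerCount_castSucc_last (i : Fin k) :
    cornerCount d A mg (i.castSucc, Fin.last k) = d i - degA A i := by
  simp [cornerCount]

@[simp] theorem cornerCount_last_castSucc (j : Fin k) :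
    cornerCount d A mg (Fin.last k, j.castSucc) = 0 := by
  simp [cornerCount]

@[simp] theorem cornerCount_last_last :
    cornerCount d A mg (Fin.last k, Fin.last k) = mg := by
  simp [cornerCount]

theorem cornerCount_of_lt {i j : Fin (k + 1)} (h : j < i) : cornerCount d A mg (i, j) = 0 := by
  induction i using Fin.lastCases with
  | last =>
    induction j using Fin.lastCases with
    | last => exact absurd h (lt_irrefl _)
    | cast j => simp
  | cast i =>
    induction j using Fin.lastCases with
    | last => exact absurd h (Fin.le_last _).not_gt
    | cast j => simpa using fun hij => absurd (Fin.castSucc_lt_castSucc_iff.1 h) hij.not_gt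

end cornerCount

theorem two_mul_sum_Astar {k : ℕ} (A : Fin k → Fin k → ℕ) (hsym : ∀ i j, A i j = A j i)
    (heven : ∀ i, 2 ∣ A i i) :
    2 * ∑ i, ∑ j, (if i ≤ j then Astar A i j else 0) = ∑ i, ∑ j, A i j := by
  have (i j : Fin k) : A i j =
      (if i ≤ j then Astar A i j else 0) + (if j ≤ i then Astar A j i else 0) := by
    unfold Astar
    rcases lt_trichotomy i j with h | rfl | h
    · simp [h.le, h.not_ge, h.ne]
    · have := heven i
      simp only [le_refl, if_true]
      omega
    · simp [h.le, h.not_ge, h.ne, hsym i j]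
  conv_rhs => enter [2, i, 2, j]; rw [this i j]
  simp only [Finset.sum_add_distrib]
  rw [Finset.sum_comm (f := fun i j => if j ≤ i then Astar A j i else 0)]
  omega

theorem sum_cornerCount {m k : ℕ} (d : Fin k → ℕ) (A : Fin k → Fin k → ℕ)
    (hsym : ∀ i j, A i j = A j i) (heven : ∀ i, 2 ∣ A i i) (hdeg : ∀ i, degA A i ≤ d i)
    (hg : ∑ i, d i ≤ m + (∑ i, ∑ j, A i j) / 2) :
    ∑ p, cornerCount d A (m + (∑ i, ∑ j, A i j) / 2 - ∑ i, d i) p = m := by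
  have h1 := two_mul_sum_Astar A hsym heven
  have h2 : ∑ i, (d i - degA A i) + ∑ i, ∑ j, A i j = ∑ i, d i := by
    rw [← Finset.sum_add_distrib]
    exact Finset.sum_congr rfl fun i _ => Nat.sub_add_cancel (hdeg i)
  simp only [Fintype.sum_prod_type, Fin.sum_univ_castSucc, cornerCount_castSucc_castSucc,
    cornerCount_castSucc_last, cornerCount_last_castSucc, cornerCount_last_last,
    Finset.sum_add_distrib, Finset.sum_const_zero]
  omega

/-- Prescribing the colors and the corner of a configuration amounts to prescribing the
multiplicity of every unordered pair of colors. -/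
theorem corner_iff_edgeCount {m k : ℕ} (d : Fin k → ℕ) (A : Fin k → Fin k → ℕ) (mg : ℕ)
    (hsym : ∀ i j, A i j = A j i) (heven : ∀ i, 2 ∣ A i i) (hdeg : ∀ i, degA A i ≤ d i)
    (hsum : ∑ p, cornerCount d A mg p = m) (ψ : Fin (2 * m) → Fin (k + 1)) :
    ((∀ i : Fin k, colorCount ψ i.castSucc = d i) ∧
        (∀ i j : Fin k, stubAdj ψ i.castSucc j.castSucc = A i j)) ↔
      ∀ p, edgeCount (stubEquiv m _ ψ) p = cornerCount d A mg p := by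
  have hcolor (i : Fin k) : colorCount ψ i.castSucc =
      ∑ j : Fin k, stubAdj ψ i.castSucc j.castSucc +
        edgeCount (stubEquiv m _ ψ) (i.castSucc, Fin.last k) := by
    rw [colorCount_eq_sum_stubAdj, Fin.sum_univ_castSucc, stubAdj_of_lt ψ (Fin.castSucc_lt_last i)]
  constructor
  · rintro ⟨hd, hA⟩
    have hoff (p : Fin (k + 1) × Fin (k + 1)) (hp : p ≠ (Fin.last k, Fin.last k)) :
        edgeCount (stubEquiv m _ ψ) p = cornerCount d A mg p := by
      obtain ⟨i, j⟩ := p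
      rcases lt_or_ge j i with h | h
      · rw [edgeCount_of_lt _ h, cornerCount_of_lt d A mg h]
      induction i using Fin.lastCases with
      | last => exact absurd (by rw [Fin.last_le_iff.1 h]) hp
      | cast i =>
        induction j using Fin.lastCases with
        | last =>
          have := hcolor i
          simp only [hd, hA] at this
          rw [cornerCount_castSucc_last, degA]
          omega
        | cast j =>
          have hij : i ≤ j := Fin.castSucc_le_castSucc_iff.1 h
          rw [cornerCount_castSucc_castSucc, if_pos hij, Astar, ← hA, ← hA]
          rcases hij.eq_or_lt with rfl | hlt
          · rw [if_pos rfl, stubAdj_self]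
            omega
          · rw [if_neg hlt.ne, stubAdj_of_lt ψ (Fin.castSucc_lt_castSucc_iff.2 hlt)]
    intro p
    by_cases hp : p = (Fin.last k, Fin.last k)
    · subst hp
      have h := (sum_edgeCount (stubEquiv m _ ψ)).trans hsum.symm
      rw [← Finset.add_sum_erase _ _ (Finset.mem_univ (Fin.last k, Fin.last k)),
        ← Finset.add_sum_erase _ (cornerCount d A mg)
          (Finset.mem_univ (Fin.last k, Fin.last k)),
        Finset.sum_congr rfl fun p hp => hoff p (Finset.ne_of_mem_erase hp)] at h
      exact Nat.add_right_cancel h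
    · exact hoff p hp
  · intro h
    have hlt (i j : Fin k) (hij : i < j) : stubAdj ψ i.castSucc j.castSucc = A i j := by
      rw [stubAdj_of_lt ψ (Fin.castSucc_lt_castSucc_iff.2 hij), h,
        cornerCount_castSucc_castSucc, if_pos hij.le, Astar, if_neg hij.ne]
    have hA (i j : Fin k) : stubAdj ψ i.castSucc j.castSucc = A i j := by
      rcases lt_trichotomy i j with hij | rfl | hij
      · exact hlt i j hij
      · rw [stubAdj_self, h, cornerCount_castSucc_castSucc, if_pos le_rfl, Astar, if_pos rfl,
          Nat.mul_div_cancel' (heven i)]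
      · rw [stubAdj_comm, hlt j i hij, hsym]
    refine ⟨fun i => ?_, hA⟩
    rw [hcolor, h, cornerCount_castSucc_last]
    simp only [hA]
    exact Nat.add_sub_cancel' (hdeg i)

theorem prod_card_fiber_pow_cornerCount {k : ℕ} (d : Fin k → ℕ) (A : Fin k → Fin k → ℕ)
    (mg : ℕ) :
    ∏ p, (Finset.univ.filter fun b : Fin (k + 1) × Fin (k + 1) => sortPair b = p).card ^
        cornerCount d A mg p =
      2 ^ (∑ p, cornerCount d A mg p - mg - ∑ i, A i i / 2) := by
  have hfactor (p : Fin (k + 1) × Fin (k + 1)) :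
      (Finset.univ.filter fun b : Fin (k + 1) × Fin (k + 1) => sortPair b = p).card ^
        cornerCount d A mg p = 2 ^ (if p.1 = p.2 then 0 else cornerCount d A mg p) := by
    obtain ⟨i, j⟩ := p
    rcases lt_or_ge j i with h | h
    · simp [cornerCount_of_lt d A mg h]
    · rw [card_sortPair_fiber h]
      split_ifs <;> simp
  rw [Finset.prod_congr rfl fun p _ => hfactor p, Finset.prod_pow_eq_pow_sum]
  congr 1
  have hdiag : ∑ p : Fin (k + 1) × Fin (k + 1), (if p.1 = p.2 then cornerCount d A mg p else 0) =
      ∑ i, A i i / 2 + mg := by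
    simp [Fintype.sum_prod_type, Fin.sum_univ_castSucc (n := k), Astar]
  have hsplit : ∑ p, cornerCount d A mg p =
      ∑ p : Fin (k + 1) × Fin (k + 1), (if p.1 = p.2 then cornerCount d A mg p else 0) +
      ∑ p : Fin (k + 1) × Fin (k + 1), (if p.1 = p.2 then 0 else cornerCount d A mg p) := by
    rw [← Finset.sum_add_distrib]
    exact Finset.sum_congr rfl fun p _ => by split_ifs <;> simp
  omega

theorem prod_factorial_cornerCount {k : ℕ} (d : Fin k → ℕ) (A : Fin k → Fin k → ℕ) (mg : ℕ) :
    ∏ p, (cornerCount d A mg p)! =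
      (∏ i : Fin k, ∏ j : Fin k, if i ≤ j then (Astar A i j)! else 1) *
        (∏ i : Fin k, (d i - degA A i)!) * mg ! := by
  simp [Fintype.prod_prod_type, Fin.prod_univ_castSucc (n := k), Finset.prod_mul_distrib,
    apply_ite Nat.factorial]

/-- The number of urn configurations `ψ : [2m] → [k+1]` (colors
`1,…,k` plus one grey color) whose type vector is `(d_1,…,d_k, 2m − ∑_{i≤k} d_i)` and whose
induced multigraph restricted to `[k]` has adjacency matrix `A` equals
`m!·2^{m−m_g−∑_i A(i,i)/2} / ((∏_{i≤j} A*(i,j)!)·(∏_i (d_i − d(A,i))!)·m_g!)`,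
where `m_{[k]} = (1/2)∑_{i,j≤k} A(i,j)`, `d_{[k]} = ∑_{i≤k} d_i`,
`m_g = m − d_{[k]} + m_{[k]}`. -/
theorem count_configurations_with_corner (m k : ℕ) (d : Fin k → ℕ)
    (A : Fin k → Fin k → ℕ)
    (hsym : ∀ i j, A i j = A j i) (heven : ∀ i, 2 ∣ A i i)
    (hdeg : ∀ i, degA A i ≤ d i)
    (hg : ∑ i, d i ≤ m + (∑ i, ∑ j, A i j) / 2) :
    ((Finset.univ.filter fun ψ : Fin (2 * m) → Fin (k + 1) =>
        (∀ i : Fin k, colorCount ψ i.castSucc = d i) ∧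
        (∀ i j : Fin k, stubAdj ψ i.castSucc j.castSucc = A i j)).card : ℚ) =
      (m ! : ℚ) *
        2 ^ (m - (m + (∑ i, ∑ j, A i j) / 2 - ∑ i, d i) - ∑ i, A i i / 2) /
        ((∏ i : Fin k, ∏ j : Fin k, if i ≤ j then ((Astar A i j)! : ℚ) else 1) *
          (∏ i : Fin k, ((d i - degA A i)! : ℚ)) *
          ((m + (∑ i, ∑ j, A i j) / 2 - ∑ i, d i)! : ℚ)) := by
  have hsum := sum_cornerCount d A hsym heven hdeg hg
  set mg := m + (∑ i, ∑ j, A i j) / 2 - ∑ i, d i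
  have hcard : (Finset.univ.filter fun ψ : Fin (2 * m) → Fin (k + 1) =>
        (∀ i : Fin k, colorCount ψ i.castSucc = d i) ∧
        (∀ i j : Fin k, stubAdj ψ i.castSucc j.castSucc = A i j)).card =
      Nat.multinomial Finset.univ (cornerCount d A mg) * 2 ^ (m - mg - ∑ i, A i i / 2) := by
    have h := card_filter_fiber_counts sortPair m (cornerCount d A mg) hsum
    rw [prod_card_fiber_pow_cornerCount, hsum] at h
    rw [← h]
    refine Finset.card_equiv (stubEquiv m _) fun ψ => ?_
    simp only [Finset.mem_filter, Finset.mem_univ, true_and]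
    exact corner_iff_edgeCount d A mg hsym heven hdeg hsum ψ
  have hspec := Nat.multinomial_spec Finset.univ (cornerCount d A mg)
  rw [prod_factorial_cornerCount, hsum] at hspec
  have hprod : ((∏ i : Fin k, ∏ j : Fin k, if i ≤ j then ((Astar A i j)! : ℚ) else 1) *
      (∏ i : Fin k, ((d i - degA A i)! : ℚ)) * (mg ! : ℚ)) =
      ((∏ i : Fin k, ∏ j : Fin k, if i ≤ j then (Astar A i j)! else 1) *
        (∏ i : Fin k, (d i - degA A i)!) * mg ! : ℕ) := by
    push_cast
    rfl
  rw [hcard, hprod, eq_div_iff, ← hspec]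
  · push_cast
    ring
  · rw [← prod_factorial_cornerCount]
    exact_mod_cast Finset.prod_ne_zero_iff.2 fun p _ => Nat.factorial_ne_zero _
end

section
/- Let X_n be a vertex exchangeable random element of A_n for each n, and let W be a multigraphon. Then t_=(A, X_n) → t_=(A, W) in probability for every k and every A ∈ A_k if and only if for every k and A ∈ A_k, lim_n P(X_n^{[k]} = A) = t_=(A, W). -/
open Finset MeasureTheory Filter

/-- The uniform distribution on `[0,1]`. -/
noncomputable def unifI : Measure ℝ := volume.restrict (Set.Icc 0 1)

/-- The induced homomorphism density `t_=(A,B) = n^{-k} ∑_{φ:[k]→[n]} 1[A = B∘(φ×φ)]`. -/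
noncomputable def tind {k n : ℕ} (A : Fin k → Fin k → ℕ) (B : Fin n → Fin n → ℕ) : ℝ :=
  (∑ φ : Fin k → Fin n,
      if ∀ i j, A i j = B (φ i) (φ j) then (1:ℝ) else 0) / (n : ℝ) ^ k

/-- The induced homomorphism density of `A` in a multigraphon `W`:
`t_=(A,W) = ∫_{[0,1]^k} ∏_{i≤j} W(x_i,x_j,A(i,j)) dx`. -/
noncomputable def tindW {k : ℕ} (A : Fin k → Fin k → ℕ) (W : ℝ → ℝ → ℕ → ℝ) : ℝ :=
  ∫ x : Fin k → ℝ,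
    ∏ i : Fin k, ∏ j : Fin k, (if i ≤ j then W (x i) (x j) (A i j) else 1)
    ∂ (Measure.pi fun _ : Fin k => unifI)

/-- `X^{[k]} = A`: the top-left `k × k` corner of `B` equals `A`. -/
def cornerEq {n k : ℕ} (B : Fin n → Fin n → ℕ) (A : Fin k → Fin k → ℕ) : Prop :=
  ∀ (i j : Fin k) (hi : (i : ℕ) < n) (hj : (j : ℕ) < n), B ⟨i, hi⟩ ⟨j, hj⟩ = A i j

open scoped Topology

/-- A multigraphon, without the symmetry condition: a measurable kernel `W` such that `W x y` is a
probability distribution on `ℕ` and `W x x` is supported on the even numbers. -/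
structure IsMultiKernel (W : ℝ → ℝ → ℕ → ℝ) : Prop where
  measurable : ∀ c, Measurable fun p : ℝ × ℝ => W p.1 p.2 c
  nonneg : ∀ x y c, 0 ≤ W x y c
  tsum_eq_one : ∀ x ∈ Set.Icc (0:ℝ) 1, ∀ y ∈ Set.Icc (0:ℝ) 1, ∑' c : ℕ, W x y c = 1
  odd_eq_zero : ∀ x ∈ Set.Icc (0:ℝ) 1, ∀ c : ℕ, W x x (2 * c + 1) = 0

/-- The product of the entries on and above the diagonal. -/
def upperProd {m : ℕ} (g : Fin m → Fin m → ℝ) : ℝ :=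
  ∏ i, ∏ j, if i ≤ j then g i j else 1

/-- The functions on pairs which take values in `s i j` for `i ≤ j` and vanish below the
diagonal. -/
def upperPi {m : ℕ} (s : Fin m → Fin m → Finset ℕ) : Finset (Fin m × Fin m → ℕ) :=
  Fintype.piFinset fun p => if p.1 ≤ p.2 then s p.1 p.2 else {0}

/-- The symmetric matrix with prescribed entries on and above the diagonal. -/
def symOf {m : ℕ} (f : Fin m × Fin m → ℕ) (i j : Fin m) : ℕ :=
  if i ≤ j then f (i, j) else f (j, i)

theorem symOf_symm {m : ℕ} (f : Fin m × Fin m → ℕ) (i j : Fin m) :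
    symOf f i j = symOf f j i := by
  rcases lt_trichotomy i j with h | rfl | h
  · simp [symOf, h.le, h.not_ge]
  · rfl
  · simp [symOf, h.le, h.not_ge]

theorem mem_upperPi {m : ℕ} {s : Fin m → Fin m → Finset ℕ} {f : Fin m × Fin m → ℕ} :
    f ∈ upperPi s ↔ ∀ i j, (i ≤ j → f (i, j) ∈ s i j) ∧ (¬ i ≤ j → f (i, j) = 0) := by
  simp only [upperPi, Fintype.mem_piFinset, Prod.forall]
  refine forall₂_congr fun i j => ?_
  by_cases h : i ≤ j <;> simp [h]

theorem symOf_injOn {m : ℕ} (s : Fin m → Fin m → Finset ℕ) :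
    Set.InjOn symOf (upperPi s : Set (Fin m × Fin m → ℕ)) := by
  intro f hf g hg hfg
  rw [Finset.mem_coe, mem_upperPi] at hf hg
  ext ⟨i, j⟩
  by_cases h : i ≤ j
  · simpa [symOf, h] using congrFun₂ hfg i j
  · rw [(hf i j).2 h, (hg i j).2 h]

section UpperProd

variable {m : ℕ} {g h : Fin m → Fin m → ℝ}

theorem upperProd_nonneg (hg : ∀ i j, 0 ≤ g i j) : 0 ≤ upperProd g :=
  Finset.prod_nonneg fun i _ => Finset.prod_nonneg fun j _ => by
    split_ifs
    exacts [hg i j, zero_le_one]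

theorem upperProd_mono (hg : ∀ i j, 0 ≤ g i j) (hgh : ∀ i j, g i j ≤ h i j) :
    upperProd g ≤ upperProd h := by
  have h0 : ∀ i j, 0 ≤ if i ≤ j then g i j else 1 := fun i j => by
    split_ifs
    exacts [hg i j, zero_le_one]
  refine Finset.prod_le_prod (fun i _ => Finset.prod_nonneg fun j _ => h0 i j) fun i _ =>
    Finset.prod_le_prod (fun j _ => h0 i j) fun j _ => ?_
  split_ifs
  exacts [hgh i j, le_rfl]

theorem upperProd_one : upperProd (fun _ _ : Fin m => 1) = 1 := by simp [upperProd]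

theorem upperProd_le_one (hg : ∀ i j, 0 ≤ g i j) (hg1 : ∀ i j, g i j ≤ 1) : upperProd g ≤ 1 :=
  (upperProd_mono hg hg1).trans_eq upperProd_one

theorem upperProd_add_le {k l : ℕ} {g : Fin (k + l) → Fin (k + l) → ℝ}
    (hg : ∀ i j, 0 ≤ g i j) (hg1 : ∀ i j, g i j ≤ 1) :
    upperProd g ≤ upperProd (fun i j : Fin k => g (i.castAdd l) (j.castAdd l)) *
      upperProd (fun i j : Fin l => g (i.natAdd k) (j.natAdd k)) := by
  have h0 : ∀ i j, 0 ≤ if i ≤ j then g i j else 1 := fun i j => by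
    split_ifs
    exacts [hg i j, zero_le_one]
  have h1 : ∀ i j, (if i ≤ j then g i j else 1) ≤ 1 := fun i j => by
    split_ifs
    exacts [hg1 i j, le_rfl]
  simp only [upperProd, Fin.prod_univ_add]
  refine mul_le_mul ?_ ?_ ?_ ?_
  · refine Finset.prod_le_prod (fun i _ => mul_nonneg (Finset.prod_nonneg fun _ _ => h0 _ _)
      (Finset.prod_nonneg fun _ _ => h0 _ _)) fun i _ => ?_
    refine (mul_le_of_le_one_right (Finset.prod_nonneg fun _ _ => h0 _ _)
      (Finset.prod_le_one (fun _ _ => h0 _ _) fun _ _ => h1 _ _)).trans_eq ?_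
    rfl
  · refine Finset.prod_le_prod (fun i _ => mul_nonneg (Finset.prod_nonneg fun _ _ => h0 _ _)
      (Finset.prod_nonneg fun _ _ => h0 _ _)) fun i _ => ?_
    refine (mul_le_of_le_one_left (Finset.prod_nonneg fun _ _ => h0 _ _)
      (Finset.prod_le_one (fun _ _ => h0 _ _) fun _ _ => h1 _ _)).trans_eq ?_
    simp [Fin.natAdd_le_natAdd_iff]
  · exact Finset.prod_nonneg fun i _ => mul_nonneg (Finset.prod_nonneg fun _ _ => h0 _ _)
      (Finset.prod_nonneg fun _ _ => h0 _ _)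
  · exact upperProd_nonneg fun i j => hg _ _

/-- A product of sums over the entries on and above the diagonal is the sum of the products. -/
theorem upperProd_sum (s : Fin m → Fin m → Finset ℕ) (w : Fin m → Fin m → ℕ → ℝ) :
    upperProd (fun i j => ∑ c ∈ s i j, w i j c) =
      ∑ f ∈ upperPi s, upperProd fun i j => w i j (symOf f i j) := by
  have key := Finset.prod_univ_sum
    (fun p : Fin m × Fin m => if p.1 ≤ p.2 then s p.1 p.2 else {0})
    (fun p c => if p.1 ≤ p.2 then w p.1 p.2 c else (1 : ℝ))
  simp only [upperProd, upperPi]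
  rw [← Fintype.prod_prod_type' fun i j => if i ≤ j then ∑ c ∈ s i j, w i j c else 1]
  refine Eq.trans (Finset.prod_congr rfl fun p _ => ?_)
    (key.trans (Finset.sum_congr rfl fun f _ => ?_))
  · by_cases hp : p.1 ≤ p.2 <;> simp [hp]
  · rw [← Fintype.prod_prod_type' fun i j => if i ≤ j then w i j (symOf f i j) else 1]
    refine Finset.prod_congr rfl fun p _ => ?_
    by_cases hp : p.1 ≤ p.2 <;> simp [hp, symOf]

end UpperProd

instance : IsProbabilityMeasure unifI := ⟨by simp [unifI]⟩

theorem ae_pi_unifI_mem_Icc (m : ℕ) :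
    ∀ᵐ x ∂(Measure.pi fun _ : Fin m => unifI), ∀ i, x i ∈ Set.Icc (0:ℝ) 1 := by
  rw [ae_all_iff]
  intro i
  have h : ∀ᵐ y ∂unifI, y ∈ Set.Icc (0:ℝ) 1 := ae_restrict_mem measurableSet_Icc
  exact (Measure.quasiMeasurePreserving_eval (μ := fun _ : Fin m => unifI) i).ae h

theorem tindW_eq_integral_upperProd {k : ℕ} (A : Fin k → Fin k → ℕ) (W : ℝ → ℝ → ℕ → ℝ) :
    tindW A W = ∫ x : Fin k → ℝ, upperProd (fun i j => W (x i) (x j) (A i j))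
      ∂(Measure.pi fun _ : Fin k => unifI) := rfl

namespace IsMultiKernel

variable {W : ℝ → ℝ → ℕ → ℝ} {x y : ℝ} {m : ℕ}

theorem hasSum (hW : IsMultiKernel W) (hx : x ∈ Set.Icc (0:ℝ) 1) (hy : y ∈ Set.Icc (0:ℝ) 1) :
    HasSum (W x y) 1 := by
  have hs : Summable (W x y) := by
    by_contra h
    exact zero_ne_one ((tsum_eq_zero_of_not_summable h).symm.trans (hW.tsum_eq_one x hx y hy))
  exact hW.tsum_eq_one x hx y hy ▸ hs.hasSum

theorem sum_le_one (hW : IsMultiKernel W) (hx : x ∈ Set.Icc (0:ℝ) 1)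
    (hy : y ∈ Set.Icc (0:ℝ) 1) (s : Finset ℕ) :
    ∑ c ∈ s, W x y c ≤ 1 :=
  sum_le_hasSum s (fun c _ => hW.nonneg x y c) (hW.hasSum hx hy)

theorem measurable_sum (hW : IsMultiKernel W) (s : Fin m → Fin m → Finset ℕ) :
    Measurable fun x : Fin m → ℝ => upperProd fun i j => ∑ c ∈ s i j, W (x i) (x j) c := by
  refine Finset.measurable_prod _ fun i _ => Finset.measurable_prod _ fun j _ => ?_
  have hij : Measurable fun x : Fin m → ℝ => (x i, x j) :=
    (measurable_pi_apply i).prodMk (measurable_pi_apply j)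
  split_ifs
  · exact Finset.measurable_fun_sum _ fun c _ => (hW.measurable c).comp hij
  · exact measurable_const

theorem norm_upperProd_sum_le (hW : IsMultiKernel W) (s : Fin m → Fin m → Finset ℕ) :
    ∀ᵐ x ∂(Measure.pi fun _ : Fin m => unifI),
      ‖upperProd fun i j => ∑ c ∈ s i j, W (x i) (x j) c‖ ≤ 1 := by
  filter_upwards [ae_pi_unifI_mem_Icc m] with x hx
  have h0 : ∀ i j, 0 ≤ ∑ c ∈ s i j, W (x i) (x j) c := fun i j =>
    Finset.sum_nonneg fun c _ => hW.nonneg _ _ c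
  rw [Real.norm_of_nonneg (upperProd_nonneg h0)]
  exact upperProd_le_one h0 fun i j => hW.sum_le_one (hx i) (hx j) _

theorem integrable_sum (hW : IsMultiKernel W) (s : Fin m → Fin m → Finset ℕ) :
    Integrable (fun x : Fin m → ℝ => upperProd fun i j => ∑ c ∈ s i j, W (x i) (x j) c)
      (Measure.pi fun _ : Fin m => unifI) :=
  .of_bound (hW.measurable_sum s).aestronglyMeasurable 1 (hW.norm_upperProd_sum_le s)

theorem integrable (hW : IsMultiKernel W) (A : Fin m → Fin m → ℕ) :
    Integrable (fun x : Fin m → ℝ => upperProd fun i j => W (x i) (x j) (A i j))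
      (Measure.pi fun _ : Fin m => unifI) := by
  simpa using hW.integrable_sum fun i j => {A i j}

theorem sum_tindW (hW : IsMultiKernel W) (s : Fin m → Fin m → Finset ℕ) :
    ∑ f ∈ upperPi s, tindW (symOf f) W =
      ∫ x : Fin m → ℝ, upperProd (fun i j => ∑ c ∈ s i j, W (x i) (x j) c)
        ∂(Measure.pi fun _ : Fin m => unifI) := by
  simp only [upperProd_sum, tindW_eq_integral_upperProd]
  rw [integral_finsetSum]
  exact fun f _ => hW.integrable _

theorem tindW_eq_zero (hW : IsMultiKernel W) {A : Fin m → Fin m → ℕ} {i : Fin m}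
    (hi : ¬ 2 ∣ A i i) : tindW A W = 0 := by
  rw [tindW_eq_integral_upperProd]
  refine integral_eq_zero_of_ae ?_
  filter_upwards [ae_pi_unifI_mem_Icc m] with x hx
  refine Finset.prod_eq_zero (Finset.mem_univ i) (Finset.prod_eq_zero (Finset.mem_univ i) ?_)
  obtain ⟨c, hc⟩ := Nat.not_even_iff_odd.1 (even_iff_two_dvd.not.2 hi)
  rw [if_pos le_rfl]
  beta_reduce
  rw [hc]
  exact hW.odd_eq_zero _ (hx i) c

/-- The total mass of the densities of all matrices of a given size is one. -/
theorem tendsto_sum_tindW (hW : IsMultiKernel W) (m : ℕ) :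
    Tendsto (fun M => ∑ f ∈ upperPi (fun _ _ : Fin m => range M), tindW (symOf f) W)
      atTop (𝓝 1) := by
  simp only [hW.sum_tindW]
  have h := tendsto_integral_of_dominated_convergence
    (μ := Measure.pi fun _ : Fin m => unifI)
    (F := fun M (x : Fin m → ℝ) => upperProd fun i j => ∑ c ∈ range M, W (x i) (x j) c)
    (f := fun _ => 1) (fun _ => 1)
    (fun M => (hW.measurable_sum fun _ _ => range M).aestronglyMeasurable)
    (integrable_const 1) (fun M => hW.norm_upperProd_sum_le _) ?_
  · simpa using h
  · filter_upwards [ae_pi_unifI_mem_Icc m] with x hx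
    rw [← upperProd_one (m := m)]
    refine tendsto_finsetProd _ fun i _ => tendsto_finsetProd _ fun j _ => ?_
    split_ifs
    · exact (hW.hasSum (hx i) (hx j)).tendsto_sum_nat
    · exact tendsto_const_nhds

end IsMultiKernel

theorem measurePreserving_castAdd_natAdd (k l : ℕ) :
    MeasurePreserving
      (fun x : Fin (k + l) → ℝ =>
        (fun i : Fin k => x (i.castAdd l), fun i : Fin l => x (i.natAdd k)))
      (Measure.pi fun _ => unifI) ((Measure.pi fun _ => unifI).prod (Measure.pi fun _ => unifI)) := by
  have h1 := (measurePreserving_piCongrLeft (fun _ : Fin (k + l) => unifI)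
    (finSumFinEquiv : Fin k ⊕ Fin l ≃ Fin (k + l))).symm
  have h2 := measurePreserving_sumPiEquivProdPi (fun _ : Fin k ⊕ Fin l => unifI)
  exact h2.comp h1

/-- If the diagonal blocks of a `(k + k) × (k + k)` matrix are prescribed to be `A`, and the
other entries are restricted to be less than `M`, the allowed values of the entries. -/
def blockEntries {k : ℕ} (A : Fin k → Fin k → ℕ) (M : ℕ) (i j : Fin (k + k)) : Finset ℕ :=
  (range M).filter fun c => (∀ a b, i = Fin.castAdd k a → j = Fin.castAdd k b → c = A a b) ∧
    ∀ a b, i = Fin.natAdd k a → j = Fin.natAdd k b → c = A a b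

theorem IsMultiKernel.sum_tindW_blockEntries_le {W : ℝ → ℝ → ℕ → ℝ} (hW : IsMultiKernel W)
    {k : ℕ} (A : Fin k → Fin k → ℕ) (M : ℕ) :
    ∑ f ∈ upperPi (blockEntries A M), tindW (symOf f) W ≤ tindW A W ^ 2 := by
  rw [hW.sum_tindW, sq]
  have hm := measurePreserving_castAdd_natAdd k k
  have hint := (hW.integrable A).mul_prod (hW.integrable A)
  have heq : tindW A W * tindW A W = ∫ x : Fin (k + k) → ℝ,
      upperProd (fun i j : Fin k => W (x (i.castAdd k)) (x (j.castAdd k)) (A i j)) *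
        upperProd (fun i j : Fin k => W (x (i.natAdd k)) (x (j.natAdd k)) (A i j))
      ∂(Measure.pi fun _ => unifI) := by
    rw [tindW_eq_integral_upperProd, ← integral_prod_mul, ← hm.map_eq, integral_map]
    · exact hm.measurable.aemeasurable
    · rw [hm.map_eq]
      exact hint.aestronglyMeasurable
  rw [heq]
  refine integral_mono_ae (hW.integrable_sum _) (hm.integrable_comp_of_integrable hint) ?_
  filter_upwards [ae_pi_unifI_mem_Icc (k + k)] with x hx
  have h0 : ∀ i j, 0 ≤ ∑ c ∈ blockEntries A M i j, W (x i) (x j) c := fun i j =>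
    Finset.sum_nonneg fun c _ => hW.nonneg _ _ c
  have hle : ∀ (i j : Fin (k + k)) (a b : Fin k), blockEntries A M i j ⊆ {A a b} →
      ∑ c ∈ blockEntries A M i j, W (x i) (x j) c ≤ W (x i) (x j) (A a b) := by
    intro i j a b h
    refine (Finset.sum_le_sum_of_subset_of_nonneg h fun c _ _ => hW.nonneg _ _ c).trans_eq ?_
    rw [Finset.sum_singleton]
  refine (upperProd_add_le h0 fun i j => hW.sum_le_one (hx i) (hx j) _).trans ?_
  refine mul_le_mul (upperProd_mono (fun _ _ => h0 _ _) fun a b => hle _ _ a b ?_)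
    (upperProd_mono (fun _ _ => h0 _ _) fun a b => hle _ _ a b ?_)
    (upperProd_nonneg fun _ _ => h0 _ _) (upperProd_nonneg fun _ _ => hW.nonneg _ _ _)
  · intro c hc
    simpa using (Finset.mem_filter.1 hc).2.1 a b rfl rfl
  · intro c hc
    simpa using (Finset.mem_filter.1 hc).2.2 a b rfl rfl

/-- The submatrix of `B` with rows and columns selected by `φ`. -/
def pullback {m n : ℕ} (B : Fin n → Fin n → ℕ) (φ : Fin m → Fin n) : Fin m → Fin m → ℕ :=
  fun i j => B (φ i) (φ j)

/-- The top-left `m × m` corner of `B`, padded with zeros if `m > n`. -/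
def corner {n : ℕ} (m : ℕ) (B : Fin n → Fin n → ℕ) : Fin m → Fin m → ℕ :=
  fun i j => if h : (i : ℕ) < n ∧ (j : ℕ) < n then B ⟨i, h.1⟩ ⟨j, h.2⟩ else 0

theorem corner_eq_pullback {m n : ℕ} (h : m ≤ n) (B : Fin n → Fin n → ℕ) :
    corner m B = pullback B (Fin.castLE h) := by
  ext i j
  simp [corner, pullback, i.2.trans_le h, j.2.trans_le h]
  rfl

theorem cornerEq_iff {m n : ℕ} (h : m ≤ n) (B : Fin n → Fin n → ℕ) (A : Fin m → Fin m → ℕ) :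
    cornerEq B A ↔ corner m B = A := by
  rw [corner_eq_pullback h]
  refine ⟨fun hB => ?_, ?_⟩
  · ext i j
    exact hB i j (i.2.trans_le h) (j.2.trans_le h)
  · rintro rfl i j hi hj
    rfl

/-- The matrices whose two diagonal `k × k` blocks are equal to `A`. -/
def diagBlocks {k : ℕ} (A : Fin k → Fin k → ℕ) : Set (Fin (k + k) → Fin (k + k) → ℕ) :=
  {C | pullback C (Fin.castAdd k) = A ∧ pullback C (Fin.natAdd k) = A}

theorem tind_eq_sum_indicator {k n : ℕ} (A : Fin k → Fin k → ℕ) (B : Fin n → Fin n → ℕ) :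
    tind A B = (∑ φ : Fin k → Fin n,
      ({A} : Set (Fin k → Fin k → ℕ)).indicator 1 (pullback B φ)) / (n : ℝ) ^ k := by
  classical
  simp only [tind, Set.indicator_apply, Set.mem_singleton_iff, Pi.one_apply, funext_iff, pullback,
    eq_comm]

theorem tind_sq_eq_sum_indicator {k n : ℕ} (A : Fin k → Fin k → ℕ) (B : Fin n → Fin n → ℕ) :
    tind A B ^ 2 = (∑ φ : Fin (k + k) → Fin n,
      (diagBlocks A).indicator 1 (pullback B φ)) / (n : ℝ) ^ (k + k) := by
  classical
  rw [tind_eq_sum_indicator, div_pow, sq, sq, ← pow_add, Finset.sum_mul_sum,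
    ← Fintype.sum_prod_type', ← (Fin.appendEquiv k k).sum_comp]
  congr 1
  refine Finset.sum_congr rfl fun p _ => ?_
  have hl : pullback (pullback B (Fin.append p.1 p.2)) (Fin.castAdd k) = pullback B p.1 := by
    ext i j
    simp [pullback]
  have hr : pullback (pullback B (Fin.append p.1 p.2)) (Fin.natAdd k) = pullback B p.2 := by
    ext i j
    simp only [pullback, Fin.append_right]
  have hp : Fin.appendEquiv k k p = Fin.append p.1 p.2 := rfl
  simp only [hp, Set.indicator_apply, Set.mem_singleton_iff, diagBlocks, Set.mem_ofPred_eq, hl, hr,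
    Pi.one_apply]
  split_ifs <;> simp_all

theorem tind_nonneg {k n : ℕ} (A : Fin k → Fin k → ℕ) (B : Fin n → Fin n → ℕ) :
    0 ≤ tind A B := by
  refine div_nonneg (Finset.sum_nonneg fun φ _ => ?_) (by positivity)
  split_ifs <;> simp

theorem tind_le_one {k n : ℕ} (A : Fin k → Fin k → ℕ) (B : Fin n → Fin n → ℕ) :
    tind A B ≤ 1 := by
  refine div_le_one_of_le₀ ?_ (by positivity)
  calc _ ≤ ∑ φ : Fin k → Fin n, (1 : ℝ) := Finset.sum_le_sum fun φ _ => by split_ifs <;> simp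
    _ = (n : ℝ) ^ k := by simp

section Fixed

variable {Ω : Type*} [MeasurableSpace Ω] {μ : Measure Ω} {n m k : ℕ}
  {X : Ω → Fin n → Fin n → ℕ}

theorem integral_sum_indicator [IsProbabilityMeasure μ] (hX : Measurable X)
    (Q : Set (Fin m → Fin m → ℕ)) :
    ∫ ω, (∑ φ : Fin m → Fin n,
        Q.indicator (1 : (Fin m → Fin m → ℕ) → ℝ) (pullback (X ω) φ)) / (n : ℝ) ^ m ∂μ =
      (∑ φ : Fin m → Fin n, μ.real {ω | pullback (X ω) φ ∈ Q}) / (n : ℝ) ^ m := by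
  have hms : ∀ φ : Fin m → Fin n, MeasurableSet {ω | pullback (X ω) φ ∈ Q} := fun φ =>
    hX (MeasurableSet.of_discrete (s := {B | pullback B φ ∈ Q}))
  have hind : ∀ φ : Fin m → Fin n,
      (fun ω => Q.indicator (1 : (Fin m → Fin m → ℕ) → ℝ) (pullback (X ω) φ)) =
      {ω | pullback (X ω) φ ∈ Q}.indicator 1 := fun φ => rfl
  rw [integral_div, integral_finsetSum]
  · simp only [hind, integral_indicator_one (hms _)]
  · intro φ _
    rw [hind]
    exact (integrable_const (1 : ℝ)).indicator (hms φ)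

theorem integral_tind [IsProbabilityMeasure μ] (hX : Measurable X) (A : Fin k → Fin k → ℕ) :
    ∫ ω, tind A (X ω) ∂μ =
      (∑ φ : Fin k → Fin n, μ.real {ω | pullback (X ω) φ ∈ ({A} : Set _)}) / (n : ℝ) ^ k := by
  simp only [tind_eq_sum_indicator, integral_sum_indicator hX]

theorem integral_tind_sq [IsProbabilityMeasure μ] (hX : Measurable X) (A : Fin k → Fin k → ℕ) :
    ∫ ω, tind A (X ω) ^ 2 ∂μ =
      (∑ φ : Fin (k + k) → Fin n, μ.real {ω | pullback (X ω) φ ∈ diagBlocks A}) /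
        (n : ℝ) ^ (k + k) := by
  simp only [tind_sq_eq_sum_indicator, integral_sum_indicator hX]

theorem measureReal_pullback_of_injective (hX : Measurable X)
    (hexch : ∀ τ : Equiv.Perm (Fin n), μ.map (fun ω => fun i j => X ω (τ i) (τ j)) = μ.map X)
    (h : m ≤ n) {φ : Fin m → Fin n} (hφ : Function.Injective φ) (Q : Set (Fin m → Fin m → ℕ)) :
    μ.real {ω | pullback (X ω) φ ∈ Q} = μ.real {ω | corner m (X ω) ∈ Q} := by
  obtain ⟨τ, hτ⟩ := Equiv.Perm.exists_extending_pair (Fin.castLE h) φ (Fin.castLE_injective h) hφ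
  have hτX : Measurable fun ω => fun i j => X ω (τ i) (τ j) :=
    (measurable_of_countable (fun B : Fin n → Fin n → ℕ => fun i j => B (τ i) (τ j))).comp hX
  have key := congrArg (fun ν => ν.real {B | pullback B (Fin.castLE h) ∈ Q}) (hexch τ)
  simp only [map_measureReal_apply hτX MeasurableSet.of_discrete,
    map_measureReal_apply hX MeasurableSet.of_discrete] at key
  simp only [corner_eq_pullback h]
  obtain rfl : (fun a => τ (Fin.castLE h a)) = φ := funext hτ
  exact key

/-- Averaging over all maps instead of the injective ones is a small error. -/
theorem abs_average_sub_corner_le [IsProbabilityMeasure μ] (hX : Measurable X)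
    (hexch : ∀ τ : Equiv.Perm (Fin n), μ.map (fun ω => fun i j => X ω (τ i) (τ j)) = μ.map X)
    (h : m ≤ n) (hn : n ≠ 0) (Q : Set (Fin m → Fin m → ℕ)) :
    |(∑ φ : Fin m → Fin n, μ.real {ω | pullback (X ω) φ ∈ Q}) / (n : ℝ) ^ m -
      μ.real {ω | corner m (X ω) ∈ Q}| ≤ 1 - (n.descFactorial m : ℝ) / (n : ℝ) ^ m := by
  classical
  have hpos : (0 : ℝ) < (n : ℝ) ^ m := by positivity
  set q := μ.real {ω | corner m (X ω) ∈ Q}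
  have hcard : ∑ φ : Fin m → Fin n, (if Function.Injective φ then (0 : ℝ) else 1) =
      (n : ℝ) ^ m - n.descFactorial m := by
    have h1 : ∀ φ : Fin m → Fin n, (if Function.Injective φ then (0 : ℝ) else 1) =
        1 - if Function.Injective φ then 1 else 0 := fun φ => by split_ifs <;> simp
    simp only [h1, Finset.sum_sub_distrib, Finset.sum_boole]
    rw [← Fintype.card_subtype,
      Fintype.card_congr (Equiv.subtypeInjectiveEquivEmbedding (Fin m) (Fin n)),
      Fintype.card_embedding_eq]
    simp
  have hsum : |∑ φ : Fin m → Fin n, (μ.real {ω | pullback (X ω) φ ∈ Q} - q)| ≤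
      (n : ℝ) ^ m - n.descFactorial m := by
    rw [← hcard]
    refine (Finset.abs_sum_le_sum_abs _ _).trans (Finset.sum_le_sum fun φ _ => ?_)
    split_ifs with hφ
    · rw [measureReal_pullback_of_injective hX hexch h hφ, sub_self, abs_zero]
    · have hp0 : 0 ≤ μ.real {ω | pullback (X ω) φ ∈ Q} := measureReal_nonneg
      have hp1 : μ.real {ω | pullback (X ω) φ ∈ Q} ≤ 1 := measureReal_le_one
      have hq0 : 0 ≤ q := measureReal_nonneg
      have hq1 : q ≤ 1 := measureReal_le_one
      exact abs_le.2 ⟨by linarith, by linarith⟩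
  have heq : (∑ φ : Fin m → Fin n, μ.real {ω | pullback (X ω) φ ∈ Q}) / (n : ℝ) ^ m - q =
      (∑ φ : Fin m → Fin n, (μ.real {ω | pullback (X ω) φ ∈ Q} - q)) / (n : ℝ) ^ m := by
    rw [Finset.sum_sub_distrib, sub_div]
    simp [hpos.ne', mul_div_cancel_left₀]
  rw [heq, abs_div, abs_of_pos hpos, ← div_self hpos.ne', ← sub_div]
  exact div_le_div_of_nonneg_right hsum hpos.le

/-- The probability that the two diagonal blocks of the corner are prescribed is bounded by
probabilities that the corner is a given matrix. -/
theorem measureReal_corner_mem_diagBlocks_le [IsProbabilityMeasure μ] (hX : Measurable X)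
    (A : Fin k → Fin k → ℕ) (M : ℕ) :
    μ.real {ω | corner (k + k) (X ω) ∈ diagBlocks A} ≤
      ∑ f ∈ upperPi (blockEntries A M), μ.real {ω | corner (k + k) (X ω) = symOf f} +
        (1 - ∑ f ∈ upperPi (fun _ _ : Fin (k + k) => range M),
          μ.real {ω | corner (k + k) (X ω) = symOf f}) := by
  have hms : ∀ P : (Fin n → Fin n → ℕ) → Prop, MeasurableSet {ω | P (X ω)} := fun P =>
    hX (MeasurableSet.of_discrete (s := {B | P B}))
  set F := upperPi (fun _ _ : Fin (k + k) => range M)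
  set E : (Fin (k + k) × Fin (k + k) → ℕ) → Set Ω := fun f => {ω | corner (k + k) (X ω) = symOf f}
  have hE : ∀ f, MeasurableSet (E f) := fun f => hms fun B => corner (k + k) B = symOf f
  have hF : μ.real (⋃ f ∈ F, E f)ᶜ = 1 - ∑ f ∈ F, μ.real (E f) := by
    rw [probReal_compl_eq_one_sub (Finset.measurableSet_biUnion _ fun f _ => hE f),
      measureReal_biUnion_finset _ fun f _ => hE f]
    intro f hf g hg hfg
    refine Set.disjoint_left.2 fun ω hω hω' => hfg (symOf_injOn _ hf hg ?_)
    exact hω.symm.trans hω'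
  rw [← hF]
  refine (measureReal_mono ?_).trans ((measureReal_union_le _ _).trans
    (add_le_add_left (measureReal_biUnion_finset_le (upperPi (blockEntries A M)) E) _))
  intro ω hω
  by_cases hωF : ω ∈ ⋃ f ∈ F, E f
  · left
    simp only [Set.mem_iUnion] at hωF ⊢
    obtain ⟨f, hf, hfω⟩ := hωF
    refine ⟨f, ?_, hfω⟩
    have hfω' : corner (k + k) (X ω) = symOf f := hfω
    rw [Set.mem_ofPred_eq, hfω'] at hω
    rw [mem_upperPi] at hf ⊢
    refine fun i j => ⟨fun hij => Finset.mem_filter.2 ⟨(hf i j).1 hij, ?_, ?_⟩, (hf i j).2⟩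
    · rintro a b rfl rfl
      simpa [pullback, symOf, hij] using congrFun₂ hω.1 a b
    · rintro a b rfl rfl
      have hab := congrFun₂ hω.2 a b
      rw [pullback, symOf, if_pos hij] at hab
      exact hab
  · exact Or.inr hωF

end Fixed

theorem eventually_measureReal_cornerEq {Ω : ℕ → Type*} [∀ n, MeasurableSpace (Ω n)]
    (μ : ∀ n, Measure (Ω n)) (X : ∀ n, Ω n → Fin n → Fin n → ℕ) {m : ℕ} (A : Fin m → Fin m → ℕ) :
    ∀ᶠ n in atTop, (μ n).real {ω | corner m (X n ω) = A} =
      ((μ n) {ω | cornerEq (X n ω) A}).toReal := by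
  filter_upwards [eventually_ge_atTop m] with n hn
  simp only [cornerEq_iff hn, measureReal_def]

theorem tendsto_measureReal_corner_symOf {Ω : ℕ → Type*} [∀ n, MeasurableSpace (Ω n)]
    {μ : ∀ n, Measure (Ω n)} {X : ∀ n, Ω n → Fin n → Fin n → ℕ} {m : ℕ}
    {W : ℝ → ℝ → ℕ → ℝ} (hW : IsMultiKernel W)
    (heven : ∀ n ω i, 2 ∣ X n ω i i)
    (H : ∀ (k : ℕ) (A : Fin k → Fin k → ℕ), (∀ i j, A i j = A j i) → (∀ i, 2 ∣ A i i) →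
      Tendsto (fun n => ((μ n) {ω | cornerEq (X n ω) A}).toReal) atTop (𝓝 (tindW A W)))
    (f : Fin m × Fin m → ℕ) :
    Tendsto (fun n => (μ n).real {ω | corner m (X n ω) = symOf f}) atTop
      (𝓝 (tindW (symOf f) W)) := by
  by_cases hf : ∀ i, 2 ∣ symOf f i i
  · exact (H m _ (symOf_symm f) hf).congr'
      ((eventually_measureReal_cornerEq μ X _).mono fun n hn => hn.symm)
  · push Not at hf
    obtain ⟨i, hi⟩ := hf
    rw [hW.tindW_eq_zero hi]
    refine tendsto_const_nhds.congr' ?_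
    filter_upwards [eventually_ge_atTop m] with n hn
    have hempty : {ω | corner m (X n ω) = symOf f} = ∅ := by
      refine Set.eq_empty_of_forall_notMem fun ω hω => hi ?_
      rw [← show corner m (X n ω) = symOf f from hω, corner_eq_pullback hn]
      exact heven n ω _
    rw [hempty, measureReal_empty]

section Sequence

variable {Ω : ℕ → Type*} [∀ n, MeasurableSpace (Ω n)] {μ : ∀ n, Measure (Ω n)}
  [∀ n, IsProbabilityMeasure (μ n)] {X : ∀ n, Ω n → Fin n → Fin n → ℕ} {m k : ℕ}

theorem tendsto_average_sub_corner (hX : ∀ n, Measurable (X n))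
    (hexch : ∀ n (τ : Equiv.Perm (Fin n)),
      (μ n).map (fun ω => fun i j => X n ω (τ i) (τ j)) = (μ n).map (X n))
    (Q : Set (Fin m → Fin m → ℕ)) :
    Tendsto (fun n => (∑ φ : Fin m → Fin n, (μ n).real {ω | pullback (X n ω) φ ∈ Q}) /
      (n : ℝ) ^ m - (μ n).real {ω | corner m (X n ω) ∈ Q}) atTop (𝓝 0) := by
  have hd : Tendsto (fun n : ℕ => 1 - (n.descFactorial m : ℝ) / (n : ℝ) ^ m) atTop (𝓝 0) := by
    have hz : ∀ᶠ n : ℕ in atTop, (n : ℝ) ^ m ≠ 0 := by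
      filter_upwards [eventually_ne_atTop 0] with n hn
      positivity
    have h1 := (Asymptotics.isEquivalent_iff_tendsto_one hz).1 (isEquivalent_descFactorial m)
    simpa using h1.const_sub 1
  refine squeeze_zero_norm' ?_ hd
  filter_upwards [eventually_ge_atTop m, eventually_ne_atTop 0] with n hmn hn
  exact abs_average_sub_corner_le (hX n) (hexch n) hmn hn Q

theorem eventually_measureReal_diagBlocks_le {W : ℝ → ℝ → ℕ → ℝ} (hW : IsMultiKernel W)
    (hX : ∀ n, Measurable (X n)) (heven : ∀ n ω i, 2 ∣ X n ω i i)
    (H : ∀ (k : ℕ) (A : Fin k → Fin k → ℕ), (∀ i j, A i j = A j i) → (∀ i, 2 ∣ A i i) →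
      Tendsto (fun n => ((μ n) {ω | cornerEq (X n ω) A}).toReal) atTop (𝓝 (tindW A W)))
    (A : Fin k → Fin k → ℕ) {δ : ℝ} (hδ : 0 < δ) :
    ∀ᶠ n in atTop, (μ n).real {ω | corner (k + k) (X n ω) ∈ diagBlocks A} ≤
      tindW A W ^ 2 + δ := by
  obtain ⟨M, hM⟩ := ((hW.tendsto_sum_tindW (k + k)).eventually_const_lt
    (sub_lt_self 1 hδ)).exists
  have hlim := (tendsto_finsetSum (upperPi (blockEntries A M)) fun f _ =>
    tendsto_measureReal_corner_symOf hW heven H f).add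
    ((tendsto_finsetSum (upperPi fun _ _ : Fin (k + k) => range M) fun f _ =>
      tendsto_measureReal_corner_symOf hW heven H f).const_sub 1)
  have hlt := hW.sum_tindW_blockEntries_le A M
  filter_upwards [hlim.eventually_lt_const (u := tindW A W ^ 2 + δ) (by linarith)] with n hn
  exact (measureReal_corner_mem_diagBlocks_le (hX n) A M).trans hn.le

end Sequence

section InProbability

variable {Ω : ℕ → Type*} [∀ n, MeasurableSpace (Ω n)] {μ : ∀ n, Measure (Ω n)}
  [∀ n, IsProbabilityMeasure (μ n)] {T : ∀ n, Ω n → ℝ} {w : ℝ}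

/-- For random variables with values in `[0, 1]`, convergence in probability to a constant implies
convergence of the expectations. -/
theorem tendsto_integral_of_tendsto_measure (hT : ∀ n, Measurable (T n))
    (h0 : ∀ n ω, 0 ≤ T n ω) (h1 : ∀ n ω, T n ω ≤ 1)
    (h : ∀ ε : ℝ, 0 < ε → Tendsto (fun n => μ n {ω | ε < |T n ω - w|}) atTop (𝓝 0)) :
    Tendsto (fun n => ∫ ω, T n ω ∂μ n) atTop (𝓝 w) := by
  have hint : ∀ n, Integrable (T n) (μ n) := fun n =>
    .of_bound (hT n).aestronglyMeasurable 1
      (ae_of_all _ fun ω => by rw [Real.norm_of_nonneg (h0 n ω)]; exact h1 n ω)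
  rw [Metric.tendsto_nhds]
  intro δ hδ
  have hlim : Tendsto (fun n => δ / 2 + (1 + |w|) * (μ n).real {ω | δ / 2 < |T n ω - w|}) atTop
      (𝓝 (δ / 2 + (1 + |w|) * 0)) :=
    (((ENNReal.tendsto_toReal_zero_iff fun n => measure_ne_top _ _).2
      (h (δ / 2) (half_pos hδ))).const_mul _).const_add _
  filter_upwards [hlim.eventually_lt_const (u := δ) (by linarith)] with n hn
  refine lt_of_le_of_lt ?_ hn
  have hms : MeasurableSet {ω | δ / 2 < |T n ω - w|} :=
    measurableSet_lt measurable_const ((hT n).sub_const w).abs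
  have hI : Integrable ({ω | δ / 2 < |T n ω - w|}.indicator (1 : Ω n → ℝ)) (μ n) :=
    (integrable_const (1 : ℝ)).indicator hms
  have hw : ∫ ω, T n ω ∂μ n - w = ∫ ω, (T n ω - w) ∂μ n := by
    rw [integral_sub (hint n) (integrable_const w)]
    simp
  rw [Real.dist_eq, hw, ← integral_indicator_one hms]
  calc |∫ ω, (T n ω - w) ∂μ n| ≤ ∫ ω, |T n ω - w| ∂μ n := abs_integral_le_integral_abs
    _ ≤ ∫ ω, (δ / 2 + (1 + |w|) * {ω | δ / 2 < |T n ω - w|}.indicator 1 ω) ∂μ n := by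
      refine integral_mono (((hint n).sub (integrable_const w)).abs)
        ((integrable_const _).add (hI.const_mul _)) fun ω => ?_
      by_cases hω : δ / 2 < |T n ω - w|
      · rw [Set.indicator_of_mem (show ω ∈ {ω | δ / 2 < |T n ω - w|} from hω)]
        have := abs_sub (T n ω) w
        rw [abs_of_nonneg (h0 n ω)] at this
        have := h1 n ω
        simp only [Pi.one_apply, mul_one]
        linarith
      · rw [Set.indicator_of_notMem (show ω ∉ {ω | δ / 2 < |T n ω - w|} from hω)]
        simpa using not_lt.1 hω
    _ = _ := by
      rw [integral_add (integrable_const _) (hI.const_mul _), integral_const_mul]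
      simp

/-- For random variables with values in `[0, 1]`, convergence of the expectations to `w` and
an asymptotic upper bound `w ^ 2` on the second moments imply convergence in probability. -/
theorem tendsto_measure_of_moments (hT : ∀ n, Measurable (T n))
    (h0 : ∀ n ω, 0 ≤ T n ω) (h1 : ∀ n ω, T n ω ≤ 1)
    (hmean : Tendsto (fun n => ∫ ω, T n ω ∂μ n) atTop (𝓝 w))
    (hsq : ∀ δ : ℝ, 0 < δ → ∀ᶠ n in atTop, ∫ ω, T n ω ^ 2 ∂μ n ≤ w ^ 2 + δ)
    {ε : ℝ} (hε : 0 < ε) :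
    Tendsto (fun n => μ n {ω | ε < |T n ω - w|}) atTop (𝓝 0) := by
  have hint : ∀ n, Integrable (T n) (μ n) := fun n =>
    .of_bound (hT n).aestronglyMeasurable 1
      (ae_of_all _ fun ω => by rw [Real.norm_of_nonneg (h0 n ω)]; exact h1 n ω)
  have hint2 : ∀ n, Integrable (fun ω => T n ω ^ 2) (μ n) := fun n =>
    .of_bound ((hT n).pow_const 2).aestronglyMeasurable 1
      (ae_of_all _ fun ω => by
        rw [Real.norm_of_nonneg (sq_nonneg _)]
        exact pow_le_one₀ (h0 n ω) (h1 n ω))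
  have hexp : ∀ n ω, (T n ω - w) ^ 2 = T n ω ^ 2 - 2 * w * T n ω + w ^ 2 := fun n ω => by ring
  have hvint : ∀ n, Integrable (fun ω => (T n ω - w) ^ 2) (μ n) := fun n => by
    simp only [hexp]
    exact ((hint2 n).sub ((hint n).const_mul _)).add (integrable_const _)
  have hv : ∀ n, ∫ ω, (T n ω - w) ^ 2 ∂μ n =
      ∫ ω, T n ω ^ 2 ∂μ n - 2 * w * ∫ ω, T n ω ∂μ n + w ^ 2 := fun n => by
    simp only [hexp]
    have hsub : Integrable (fun ω => T n ω ^ 2 - 2 * w * T n ω) (μ n) :=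
      (hint2 n).sub ((hint n).const_mul _)
    rw [integral_add hsub (integrable_const _),
      integral_sub (hint2 n) ((hint n).const_mul _), integral_const_mul]
    simp
  have hreal : Tendsto (fun n => (μ n).real {ω | ε < |T n ω - w|}) atTop (𝓝 0) := by
    rw [Metric.tendsto_nhds]
    intro η hη
    have hpos : 0 < ε ^ 2 * η / 3 := by positivity
    have hm := (hmean.const_mul (2 * w)).eventually_const_lt
      (u := 2 * w * w - ε ^ 2 * η / 3) (by linarith)
    filter_upwards [hm, hsq _ hpos] with n hn1 hn2
    have hcheb := mul_meas_ge_le_integral_of_nonneg (ae_of_all _ fun ω => sq_nonneg (T n ω - w))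
      (hvint n) (ε ^ 2)
    have hsub : (μ n).real {ω | ε < |T n ω - w|} ≤ (μ n).real {ω | ε ^ 2 ≤ (T n ω - w) ^ 2} := by
      refine measureReal_mono fun ω hω => ?_
      rw [Set.mem_ofPred_eq, ← sq_abs (T n ω - w)]
      exact pow_le_pow_left₀ hε.le (le_of_lt hω) 2
    rw [hv] at hcheb
    rw [Real.dist_eq, sub_zero, abs_of_nonneg measureReal_nonneg]
    refine hsub.trans_lt (lt_of_mul_lt_mul_left ?_ (sq_nonneg ε))
    linarith
  exact (ENNReal.tendsto_toReal_zero_iff fun n => measure_ne_top _ _).1 hreal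

end InProbability

/-- Let `X_n` be a vertex exchangeable random element of `A_n` for each
`n` and let `W` be a multigraphon.  Then `t_=(A, X_n) → t_=(A, W)` in probability for
every `k` and every `A ∈ A_k` if and only if `lim_n P(X_n^{[k]} = A) = t_=(A,W)` for
every `k` and `A ∈ A_k`. -/
theorem tendsto_in_prob_iff_corner_distribution
    (Ω : ℕ → Type) [∀ n, MeasurableSpace (Ω n)]
    (μ : ∀ n, Measure (Ω n)) (hprob : ∀ n, IsProbabilityMeasure (μ n))
    (X : ∀ n, Ω n → Fin n → Fin n → ℕ)
    (hXmeas : ∀ n, Measurable (X n))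
    (hA : ∀ n ω, (∀ i j, X n ω i j = X n ω j i) ∧ ∀ i, 2 ∣ X n ω i i)
    (hexch : ∀ n (τ : Equiv.Perm (Fin n)),
      Measure.map (fun ω => fun i j => X n ω (τ i) (τ j)) (μ n) =
        Measure.map (X n) (μ n))
    (W : ℝ → ℝ → ℕ → ℝ)
    (hmeas : ∀ c, Measurable fun p : ℝ × ℝ => W p.1 p.2 c)
    (hnonneg : ∀ x y c, 0 ≤ W x y c)
    (hsymW : ∀ x y c, W x y c = W y x c)
    (hsum : ∀ x ∈ Set.Icc (0:ℝ) 1, ∀ y ∈ Set.Icc (0:ℝ) 1, ∑' c : ℕ, W x y c = 1)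
    (hodd : ∀ x ∈ Set.Icc (0:ℝ) 1, ∀ c : ℕ, W x x (2 * c + 1) = 0) :
    (∀ (k : ℕ) (A : Fin k → Fin k → ℕ),
        (∀ i j, A i j = A j i) → (∀ i, 2 ∣ A i i) →
        ∀ ε : ℝ, 0 < ε →
        Tendsto (fun n => (μ n) {ω | ε < |tind A (X n ω) - tindW A W|})
          atTop (nhds 0)) ↔
    (∀ (k : ℕ) (A : Fin k → Fin k → ℕ),
        (∀ i j, A i j = A j i) → (∀ i, 2 ∣ A i i) →
        Tendsto (fun n => ((μ n) {ω | cornerEq (X n ω) A}).toReal)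
          atTop (nhds (tindW A W))) := by
  have hW : IsMultiKernel W := ⟨hmeas, hnonneg, hsum, hodd⟩
  have hTmeas : ∀ (k : ℕ) (A : Fin k → Fin k → ℕ) n, Measurable fun ω => tind A (X n ω) :=
    fun k A n => (measurable_of_countable (tind A)).comp (hXmeas n)
  have hdiff : ∀ (k : ℕ) (A : Fin k → Fin k → ℕ),
      Tendsto (fun n => ∫ ω, tind A (X n ω) ∂μ n - (μ n).real {ω | corner k (X n ω) = A})
        atTop (𝓝 0) := fun k A => by
    simp only [integral_tind (hXmeas _)]
    exact tendsto_average_sub_corner hXmeas hexch {A}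
  constructor
  · intro H k A hsymm heven
    have hmean := tendsto_integral_of_tendsto_measure (hTmeas k A)
      (fun n ω => tind_nonneg A (X n ω)) (fun n ω => tind_le_one A (X n ω)) (H k A hsymm heven)
    have hlim := hmean.sub (hdiff k A)
    simp only [sub_sub_cancel, sub_zero] at hlim
    exact hlim.congr' (eventually_measureReal_cornerEq μ X A)
  · intro H k A hsymm heven ε hε
    refine tendsto_measure_of_moments (hTmeas k A)
      (fun n ω => tind_nonneg A (X n ω)) (fun n ω => tind_le_one A (X n ω)) ?_ ?_ hε
    · have hlim := (hdiff k A).add ((H k A hsymm heven).congr'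
        ((eventually_measureReal_cornerEq μ X A).mono fun n hn => hn.symm))
      simpa only [sub_add_cancel, zero_add] using hlim
    · intro δ hδ
      have hsq := tendsto_average_sub_corner hXmeas hexch (diagBlocks A)
      filter_upwards [hsq.eventually_lt_const (half_pos hδ),
        eventually_measureReal_diagBlocks_le hW hXmeas (fun n ω => (hA n ω).2) H A
          (half_pos hδ)] with n hn1 hn2
      rw [integral_tind_sq (hXmeas n)]
      linarith
end

section
/- Let X be an infinite vertex exchangeable array with all entries bounded by a constant m. Then for all exponents μ_{i,j} (1 ≤ i ≤ j ≤ k) and ν_i (1 ≤ i ≤ k), and disjoint sets J(1),...,J(k) ⊆ ℕ∖[k] with |J(i)| = ν_i: E[∏_{i≤j≤k} X(i,j)^{μ_{i,j}} · ∏_{i=1}^k D(X,i)^{ν_i}] = E[∏_{i≤j≤k} X(i,j)^{μ_{i,j}} · ∏_{i=1}^k ∏_{j∈J(i)} X(i,j)], where D(X,i) = lim_n (1/n)Σ_{j≤n} X(i,j). -/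
open Finset MeasureTheory Filter

/-- The average degree of an infinite array at vertex `i` (defined via `limsup`; for a
vertex exchangeable integrable array the limit exists almost surely, so this agrees
almost surely with `D(X,i) = lim_n (1/n) ∑_{j<n} X(i,j)`). -/
noncomputable def DX (X : ℕ → ℕ → ℕ) (i : ℕ) : ℝ :=
  Filter.limsup (fun n : ℕ => (∑ j ∈ Finset.range n, (X i j : ℝ)) / n) atTop

open scoped Topology

/-- A sequence of integrable real functions with summable `L¹` norms is almost everywhere
absolutely summable. -/
theorem ae_summable_abs_of_integral_abs_le {Ω : Type*} [MeasurableSpace Ω] {μ : Measure Ω}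
    {f : ℕ → Ω → ℝ} (hf : ∀ n, Integrable (f n) μ) {b : ℕ → ℝ} (hb : Summable b)
    (hfb : ∀ n, ∫ ω, |f n ω| ∂μ ≤ b n) : ∀ᵐ ω ∂μ, Summable fun n => |f n ω| := by
  have hmeas : ∀ n, AEMeasurable (fun ω => ENNReal.ofReal |f n ω|) μ := fun n =>
    (hf n).abs.aestronglyMeasurable.aemeasurable.ennreal_ofReal
  have hfin : ∫⁻ ω, ∑' n, ENNReal.ofReal |f n ω| ∂μ ≠ ⊤ := by
    rw [lintegral_tsum hmeas]
    refine ne_top_of_le_ne_top hb.tsum_ofReal_ne_top (ENNReal.tsum_le_tsum fun n => ?_)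
    rw [← ofReal_integral_eq_lintegral_ofReal (hf n).abs (ae_of_all _ fun _ => abs_nonneg _)]
    exact ENNReal.ofReal_le_ofReal (hfb n)
  filter_upwards [ae_lt_top' (AEMeasurable.tsum hmeas) hfin] with ω hω
  have h := ENNReal.summable_toReal hω.ne
  simpa [ENNReal.toReal_ofReal] using h

/-- The mixed second moment of two partial sums of a sequence whose second moments depend only
on whether the two indices agree. -/
theorem integral_sum_range_mul_sum_range {Ω : Type*} [MeasurableSpace Ω] {μ : Measure Ω}
    {Y : ℕ → Ω → ℝ} {a b : ℝ} (hint : ∀ i j, Integrable (fun ω => Y i ω * Y j ω) μ)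
    (ha : ∀ i, ∫ ω, Y i ω * Y i ω ∂μ = a)
    (hb : ∀ i j, i ≠ j → ∫ ω, Y i ω * Y j ω ∂μ = b) {n p : ℕ} (hnp : n ≤ p) :
    ∫ ω, (∑ i ∈ range n, Y i ω) * (∑ j ∈ range p, Y j ω) ∂μ = n * p * b + n * (a - b) := by
  simp_rw [sum_mul_sum]
  rw [integral_finsetSum _ fun i _ => integrable_finsetSum _ fun j _ => hint i j]
  have hrow : ∀ i ∈ range n, ∫ ω, ∑ j ∈ range p, Y i ω * Y j ω ∂μ = p * b + (a - b) := by
    intro i hi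
    rw [integral_finsetSum _ fun j _ => hint i j]
    have hterm : ∀ j ∈ range p, ∫ ω, Y i ω * Y j ω ∂μ = b + if i = j then a - b else 0 := by
      intro j _
      split_ifs with h
      · subst h; rw [ha]; ring
      · rw [hb i j h]; ring
    have hip : i < p := (Finset.mem_range.1 hi).trans_le hnp
    rw [sum_congr rfl hterm, sum_add_distrib, sum_ite_eq]
    simp [hip]
  rw [sum_congr rfl hrow]
  simp only [sum_const, card_range, nsmul_eq_mul]
  ring

/-- Averages of a bounded nonnegative sequence whose second moments depend only on whether the
two indices agree converge almost surely. -/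
theorem ae_exists_tendsto_average {Ω : Type*} [MeasurableSpace Ω] {μ : Measure Ω}
    [IsFiniteMeasure μ] {Y : ℕ → Ω → ℝ} {a b m : ℝ} (hY : ∀ i, Measurable (Y i))
    (hY0 : ∀ i ω, 0 ≤ Y i ω) (hYm : ∀ i ω, Y i ω ≤ m)
    (ha : ∀ i, ∫ ω, Y i ω * Y i ω ∂μ = a)
    (hb : ∀ i j, i ≠ j → ∫ ω, Y i ω * Y j ω ∂μ = b) :
    ∀ᵐ ω ∂μ, ∃ l, Tendsto (fun n : ℕ => (∑ j ∈ range n, Y j ω) / n) atTop (𝓝 l) := by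
  set S : ℕ → Ω → ℝ := fun n ω => ∑ j ∈ range n, Y j ω with hS
  have hint : ∀ i j, Integrable (fun ω => Y i ω * Y j ω) μ := fun i j =>
    Integrable.of_bound ((hY i).mul (hY j)).aestronglyMeasurable (m * m) (ae_of_all _ fun ω => by
      rw [Real.norm_of_nonneg (mul_nonneg (hY0 i ω) (hY0 j ω))]
      exact mul_le_mul (hYm i ω) (hYm j ω) (hY0 j ω) ((hY0 i ω).trans (hYm i ω)))
  have hSS : ∀ n p, Integrable (fun ω => S n ω * S p ω) μ := fun n p => by
    simp only [hS, sum_mul_sum]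
    exact integrable_finsetSum _ fun i _ => integrable_finsetSum _ fun j _ => hint i j
  have hYint : ∀ i, Integrable (Y i) μ := fun i =>
    Integrable.of_bound (hY i).aestronglyMeasurable m (ae_of_all _ fun ω => by
      rw [Real.norm_of_nonneg (hY0 i ω)]; exact hYm i ω)
  have hSint : ∀ n, Integrable (S n) μ := fun n => integrable_finsetSum _ fun i _ => hYint i
  have hexp : ∀ n p : ℕ, ∀ ω, (S n ω / n - S p ω / p) ^ 2 = (S n ω * S n ω) * ((n : ℝ) ^ 2)⁻¹ -
      (S n ω * S p ω) * (2 * ((n : ℝ) * p)⁻¹) + (S p ω * S p ω) * ((p : ℝ) ^ 2)⁻¹ := by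
    intro n p ω
    simp only [div_eq_mul_inv, mul_inv]
    ring
  have hSS' : ∀ n p : ℕ, Integrable (fun ω => (S n ω * S n ω) * ((n : ℝ) ^ 2)⁻¹ -
      (S n ω * S p ω) * (2 * ((n : ℝ) * p)⁻¹)) μ := fun n p =>
    ((hSS n n).mul_const _).sub ((hSS n p).mul_const _)
  have hdiffint : ∀ n p : ℕ, Integrable (fun ω => (S n ω / n - S p ω / p) ^ 2) μ := by
    intro n p
    simp_rw [hexp]
    exact (hSS' n p).add ((hSS p p).mul_const _)
  have hdiff : ∀ n p : ℕ, 0 < n → n ≤ p →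
      ∫ ω, (S n ω / n - S p ω / p) ^ 2 ∂μ ≤ |a - b| / n := by
    intro n p hn hnp
    have hn' : (0 : ℝ) < n := by exact_mod_cast hn
    have hnp' : (n : ℝ) ≤ p := by exact_mod_cast hnp
    have hp' : (0 : ℝ) < p := hn'.trans_le hnp'
    have heq : ∫ ω, (S n ω / n - S p ω / p) ^ 2 ∂μ = (a - b) * (1 / n - 1 / p) := by
      simp_rw [hexp]
      rw [integral_add (hSS' n p) ((hSS p p).mul_const _), integral_sub ((hSS n n).mul_const _) ((hSS n p).mul_const _)]
      simp_rw [integral_mul_const]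
      rw [integral_sum_range_mul_sum_range hint ha hb le_rfl,
        integral_sum_range_mul_sum_range hint ha hb hnp,
        integral_sum_range_mul_sum_range hint ha hb le_rfl]
      field_simp
      ring
    rw [heq, div_eq_mul_one_div |a - b|]
    have h1 : (1 : ℝ) / p ≤ 1 / n := one_div_le_one_div_of_le hn' hnp'
    have h2 : (0 : ℝ) < 1 / p := by positivity
    exact mul_le_mul (le_abs_self _) (by linarith) (by linarith) (abs_nonneg _)
  set c : ℕ → ℕ := fun k => (k + 1) ^ 4 with hc
  have hcmono : Monotone c := fun i j hij => by simp only [hc]; gcongr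
  set d : ℕ → Ω → ℝ := fun k ω => S (c k) ω / c k - S (c (k + 1)) ω / c (k + 1) with hd
  have hdint : ∀ k, Integrable (d k) μ := fun k =>
    ((hSint _).div_const _).sub ((hSint _).div_const _)
  have hdabs : ∀ k, ∫ ω, |d k ω| ∂μ ≤ (|a - b| + μ.real Set.univ) * (1 / ((k + 1 : ℕ) : ℝ) ^ 2) := by
    intro k
    have hk : (0 : ℝ) < ((k + 1 : ℕ) : ℝ) ^ 2 := by positivity
    set r : ℝ := ((k + 1 : ℕ) : ℝ) ^ 2 with hr
    have hpt : ∀ ω, |d k ω| ≤ r * d k ω ^ 2 + 1 / r := by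
      intro ω
      have h1 : r * (1 / r) = 1 := by field_simp
      have h2 : 0 ≤ 1 / r := by positivity
      rw [← sq_abs]
      nlinarith [mul_nonneg h2 (sq_nonneg (r * |d k ω| - 1)), abs_nonneg (d k ω)]
    have hck : (c k : ℝ) = r ^ 2 := by simp only [hc, hr]; push_cast; ring
    calc ∫ ω, |d k ω| ∂μ ≤ ∫ ω, (r * d k ω ^ 2 + 1 / r) ∂μ :=
          integral_mono (hdint k).abs (((hdiffint _ _).const_mul r).add (integrable_const _)) hpt
      _ = r * ∫ ω, d k ω ^ 2 ∂μ + μ.real Set.univ * (1 / r) := by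
          rw [integral_add ((hdiffint _ _).const_mul r) (integrable_const _), integral_const_mul]
          simp only [integral_const, smul_eq_mul, hd]
      _ ≤ r * (|a - b| / c k) + μ.real Set.univ * (1 / r) := by
          gcongr
          exact hdiff _ _ (by simp only [hc]; positivity) (hcmono (Nat.le_succ k))
      _ = (|a - b| + μ.real Set.univ) * (1 / r) := by
          rw [hck]; field_simp
  have hsum : Summable fun k : ℕ => (|a - b| + μ.real Set.univ) * (1 / ((k + 1 : ℕ) : ℝ) ^ 2) :=
    ((summable_nat_add_iff 1).2
      (Real.summable_one_div_nat_pow.2 (one_lt_two : 1 < 2))).mul_left _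
  filter_upwards [ae_summable_abs_of_integral_abs_le hdint hsum hdabs] with ω hω
  obtain ⟨l, hl⟩ := cauchySeq_tendsto_of_complete
    (cauchySeq_of_summable_dist (f := fun k => S (c k) ω / c k) hω)
  refine ⟨l, tendsto_div_of_monotone_of_exists_subseq_tendsto_div (fun n => S n ω) l
    (fun i j hij => sum_le_sum_of_subset_of_nonneg (range_mono hij) fun _ _ _ => hY0 _ _)
    fun q hq => ⟨c, ?_, ?_, hl⟩⟩
  · have hlim : Tendsto (fun n : ℕ => (1 + 1 / ((n : ℝ) + 1)) ^ 4) atTop (𝓝 ((1 + 0) ^ 4)) :=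
      (tendsto_const_nhds.add tendsto_one_div_add_atTop_nhds_zero_nat).pow 4
    filter_upwards [hlim.eventually_lt_const (by simpa using hq)] with n hn
    have hn1 : (0 : ℝ) < (n : ℝ) + 1 := by positivity
    have heq : (c (n + 1) : ℝ) = (1 + 1 / ((n : ℝ) + 1)) ^ 4 * c n := by
      simp only [hc]; push_cast; rw [← mul_pow]; congr 1; field_simp
    rw [heq]
    gcongr
  · exact tendsto_atTop_mono (fun n => (Nat.le_succ n).trans (Nat.le_self_pow (by norm_num) _))
      tendsto_id

/-- Convergence of the averages of a shifted sequence implies that of the averages of the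
sequence itself, with the same limit. -/
theorem tendsto_average_of_tendsto_average_shift {y : ℕ → ℝ} {l : ℝ} (N : ℕ)
    (h : Tendsto (fun n : ℕ => (∑ j ∈ range n, y (j + N)) / n) atTop (𝓝 l)) :
    Tendsto (fun n : ℕ => (∑ j ∈ range n, y j) / n) atTop (𝓝 l) := by
  rw [← tendsto_add_atTop_iff_nat N]
  have h1 := (h.mul (tendsto_natCast_div_add_atTop (N : ℝ))).add
    ((tendsto_const_nhds (x := ∑ j ∈ range N, y j)).mul
      ((tendsto_natCast_atTop_atTop (R := ℝ)).comp (tendsto_add_atTop_nat N)).inv_tendsto_atTop)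
  simp only [mul_one, mul_zero, add_zero] at h1
  refine h1.congr' ?_
  filter_upwards [eventually_gt_atTop 0] with n hn
  have hn' : (0 : ℝ) < n := by exact_mod_cast hn
  rw [add_comm n N, sum_range_add]
  simp only [Pi.inv_apply, Function.comp_apply, add_comm N]
  push_cast
  field_simp
  ring

theorem measurable_DX (i : ℕ) : Measurable fun x : ℕ → ℕ → ℕ => DX x i := by
  unfold DX
  refine Measurable.limsup fun n => Measurable.div_const ?_ _
  exact Finset.measurable_sum _ fun j _ =>
    measurable_from_top.comp ((measurable_pi_apply j).comp (measurable_pi_apply i))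

theorem average_nonneg (x : ℕ → ℕ → ℕ) (i n : ℕ) :
    0 ≤ (∑ j ∈ range n, (x i j : ℝ)) / n := by positivity

theorem average_le {x : ℕ → ℕ → ℕ} {m : ℕ} (hx : ∀ i j, x i j ≤ m) (i n : ℕ) :
    (∑ j ∈ range n, (x i j : ℝ)) / n ≤ m := by
  refine div_le_of_le_mul₀ (by positivity) (by positivity) ?_
  calc ∑ j ∈ range n, (x i j : ℝ) ≤ ∑ _j ∈ range n, (m : ℝ) :=
        sum_le_sum fun j _ => by exact_mod_cast hx i j
    _ = m * n := by simp [mul_comm]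

theorem abs_DX_le {x : ℕ → ℕ → ℕ} {m : ℕ} (hx : ∀ i j, x i j ≤ m) (i : ℕ) : |DX x i| ≤ m := by
  have hbdd : IsBoundedUnder (· ≤ ·) atTop
      fun n : ℕ => (∑ j ∈ range n, (x i j : ℝ)) / n :=
    isBoundedUnder_of ⟨m, average_le hx i⟩
  have hcobdd : IsCoboundedUnder (· ≤ ·) atTop
      fun n : ℕ => (∑ j ∈ range n, (x i j : ℝ)) / n :=
    (isBoundedUnder_of ⟨0, average_nonneg x i⟩ :
      IsBoundedUnder (· ≥ ·) atTop _).isCoboundedUnder_le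
  have h0 : 0 ≤ DX x i :=
    le_limsup_of_frequently_le (Frequently.of_forall (average_nonneg x i)) hbdd
  rw [abs_of_nonneg h0]
  exact limsup_le_of_le hcobdd (Eventually.of_forall (average_le hx i))

/-- Simultaneous exchange of the rows and columns `a` and `b` of an array. -/
def swapIndices (a b : ℕ) (x : ℕ → ℕ → ℕ) : ℕ → ℕ → ℕ :=
  fun i j => x (Equiv.swap a b i) (Equiv.swap a b j)

theorem DX_swapIndices (x : ℕ → ℕ → ℕ) {a b i : ℕ} (ha : i ≠ a) (hb : i ≠ b) :
    DX (swapIndices a b x) i = DX x i := by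
  refine limsup_congr ?_
  filter_upwards [eventually_gt_atTop a, eventually_gt_atTop b] with n hna hnb
  simp only [swapIndices, Equiv.swap_apply_of_ne_of_ne ha hb]
  rw [Equiv.Perm.sum_comp (Equiv.swap a b) (range n) (fun j => (x i j : ℝ))]
  intro j hj
  by_contra hjn
  simp only [coe_range, Set.mem_Iio, not_lt] at hjn
  exact hj (Equiv.swap_apply_of_ne_of_ne (by omega) (by omega))

theorem finite_swap_support (a b : ℕ) : {i | Equiv.swap a b i ≠ i}.Finite :=
  (Set.toFinite {a, b}).subset fun i hi => by
    by_contra h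
    simp only [Set.mem_insert_iff, Set.mem_singleton_iff, not_or] at h
    exact hi (Equiv.swap_apply_of_ne_of_ne h.1 h.2)

theorem measurable_entry (i j : ℕ) : Measurable fun x : ℕ → ℕ → ℕ => (x i j : ℝ) :=
  measurable_from_top.comp ((measurable_pi_apply j).comp (measurable_pi_apply i))

theorem measurable_swapIndices (a b : ℕ) : Measurable (swapIndices a b) :=
  measurable_pi_lambda _ fun _ => measurable_pi_lambda _ fun _ =>
    (measurable_pi_apply _).comp (measurable_pi_apply _)

/-- In a bounded array whose distribution is invariant under transpositions, the averages of each
row converge almost surely to the average degree. -/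
theorem ae_tendsto_average_DX {Ω : Type*} [MeasurableSpace Ω] {μ : Measure Ω} [IsFiniteMeasure μ]
    {X : Ω → ℕ → ℕ → ℕ} (hX : Measurable X) {m : ℕ} (hbdd : ∀ ω i j, X ω i j ≤ m)
    (hswap : ∀ a b, ∀ f : (ℕ → ℕ → ℕ) → ℝ, Measurable f →
      ∫ ω, f (swapIndices a b (X ω)) ∂μ = ∫ ω, f (X ω) ∂μ) (i : ℕ) :
    ∀ᵐ ω ∂μ, Tendsto (fun n : ℕ => (∑ j ∈ range n, (X ω i j : ℝ)) / n) atTop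
      (𝓝 (DX (X ω) i)) := by
  have hmove : ∀ a b p q, i ≠ a → i ≠ b →
      ∫ ω, (X ω i (Equiv.swap a b p) : ℝ) * X ω i (Equiv.swap a b q) ∂μ =
        ∫ ω, (X ω i p : ℝ) * X ω i q ∂μ := by
    intro a b p q ha hb
    have h := hswap a b (fun x => (x i p : ℝ) * x i q)
      ((measurable_entry i p).mul (measurable_entry i q))
    simpa only [swapIndices, Equiv.swap_apply_of_ne_of_ne ha hb] using h
  have hdiag : ∀ p p', i ≠ p → i ≠ p' →
      ∫ ω, (X ω i p : ℝ) * X ω i p ∂μ = ∫ ω, (X ω i p' : ℝ) * X ω i p' ∂μ := by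
    intro p p' hp hp'
    simpa using (hmove p p' p p hp hp').symm
  have hoff : ∀ p q p' q', i ≠ p → i ≠ q → i ≠ p' → i ≠ q' → p ≠ q → p' ≠ q' →
      ∫ ω, (X ω i p : ℝ) * X ω i q ∂μ = ∫ ω, (X ω i p' : ℝ) * X ω i q' ∂μ := by
    intro p q p' q' hp hq hp' hq' hpq hpq'
    have h1 := hmove p p' p q hp hp'
    rw [Equiv.swap_apply_left] at h1
    have hr : p' ≠ Equiv.swap p p' q := fun h =>
      hpq ((Equiv.swap p p').injective (by rw [← h, Equiv.swap_apply_left]))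
    have hir : i ≠ Equiv.swap p p' q := fun h =>
      hq ((Equiv.swap p p').injective (by rw [← h, Equiv.swap_apply_of_ne_of_ne hp hp']))
    have h2 := hmove (Equiv.swap p p' q) q' p' (Equiv.swap p p' q) hir hq'
    rw [Equiv.swap_apply_left, Equiv.swap_apply_of_ne_of_ne hr hpq'] at h2
    rw [← h1, ← h2]
  have hconv := ae_exists_tendsto_average (μ := μ) (Y := fun j ω => (X ω i (j + (i + 1)) : ℝ))
    (m := m) (fun j => (measurable_entry i _).comp hX) (fun _ _ => Nat.cast_nonneg _)
    (fun j ω => by exact_mod_cast hbdd ω i _)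
    (fun j => hdiag (j + (i + 1)) (i + 1) (by omega) (by omega))
    (fun j l hjl => hoff (j + (i + 1)) (l + (i + 1)) (i + 1) (i + 2) (by omega) (by omega)
      (by omega) (by omega) (by omega) (by omega))
  filter_upwards [hconv] with ω ⟨l, hl⟩
  have hlim := tendsto_average_of_tendsto_average_shift (y := fun j => (X ω i j : ℝ)) (i + 1) hl
  rwa [DX, hlim.limsup_eq]

/-- If the correlation of a bounded functional with the entry `(i, j)` is eventually constant
in `j`, then it equals the correlation with the average degree at `i`. -/
theorem integral_mul_DX {Ω : Type*} [MeasurableSpace Ω] {μ : Measure Ω} [IsFiniteMeasure μ]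
    {X : Ω → ℕ → ℕ → ℕ} (hX : Measurable X) {m : ℕ} (hbdd : ∀ ω i j, X ω i j ≤ m) {i : ℕ}
    (hlim : ∀ᵐ ω ∂μ, Tendsto (fun n : ℕ => (∑ j ∈ range n, (X ω i j : ℝ)) / n) atTop
      (𝓝 (DX (X ω) i)))
    {A : Ω → ℝ} (hA : Measurable A) {C : ℝ} (hAC : ∀ ω, |A ω| ≤ C) {c : ℝ}
    (hc : ∀ᶠ j in atTop, ∫ ω, A ω * X ω i j ∂μ = c) :
    ∫ ω, A ω * DX (X ω) i ∂μ = c := by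
  have hmeas : ∀ j, Measurable fun ω => (X ω i j : ℝ) := fun j => (measurable_entry i j).comp hX
  have hint : ∀ j, Integrable (fun ω => A ω * X ω i j) μ := fun j =>
    Integrable.of_bound (hA.mul (hmeas j)).aestronglyMeasurable (C * m) (ae_of_all _ fun ω => by
      rw [norm_mul, Real.norm_eq_abs, Real.norm_natCast]
      exact mul_le_mul (hAC ω) (by exact_mod_cast hbdd ω i j) (Nat.cast_nonneg _)
        ((abs_nonneg _).trans (hAC ω)))
  have hcesaro := (tendsto_const_nhds.congr' (hc.mono fun _ h => h.symm)).cesaro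
  refine tendsto_nhds_unique ?_ hcesaro
  have hdom := tendsto_integral_of_dominated_convergence (μ := μ)
    (F := fun (n : ℕ) ω => A ω * ((∑ j ∈ range n, (X ω i j : ℝ)) / n))
    (f := fun ω => A ω * DX (X ω) i) (fun _ => C * m)
    (fun n => (hA.mul ((Finset.measurable_sum _ fun j _ => hmeas j).div_const
      _)).aestronglyMeasurable) (integrable_const _)
    (fun n => ae_of_all _ fun ω => by
      rw [norm_mul, Real.norm_eq_abs, Real.norm_of_nonneg (average_nonneg _ _ _)]
      exact mul_le_mul (hAC ω) (average_le (hbdd ω) i n) (average_nonneg _ _ _)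
        ((abs_nonneg _).trans (hAC ω)))
    (hlim.mono fun ω h => h.const_mul _)
  refine hdom.congr fun n => ?_
  rw [← integral_finsetSum _ fun j _ => hint j, ← integral_const_mul]
  refine integral_congr_ae (ae_of_all _ fun ω => ?_)
  simp only [← mul_sum]
  ring

theorem exists_abs_prod_le {α ι : Type*} (T : Set α) (s : Finset ι) {f : ι → α → ℝ}
    (hf : ∀ i ∈ s, ∃ C, ∀ x ∈ T, |f i x| ≤ C) : ∃ C, ∀ x ∈ T, |∏ i ∈ s, f i x| ≤ C := by
  choose! C hC using hf
  refine ⟨∏ i ∈ s, C i, fun x hx => ?_⟩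
  rw [abs_prod]
  exact prod_le_prod (fun _ _ => abs_nonneg _) fun i hi => hC i hi x hx

theorem exists_abs_mul_le {α : Type*} {T : Set α} {f g : α → ℝ}
    (hf : ∃ C, ∀ x ∈ T, |f x| ≤ C) (hg : ∃ C, ∀ x ∈ T, |g x| ≤ C) :
    ∃ C, ∀ x ∈ T, |f x * g x| ≤ C := by
  obtain ⟨C, hC⟩ := hf
  obtain ⟨C', hC'⟩ := hg
  refine ⟨C * C', fun x hx => ?_⟩
  rw [abs_mul]
  exact mul_le_mul (hC x hx) (hC' x hx) (abs_nonneg _) ((abs_nonneg _).trans (hC x hx))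

/-- Each entry `X(i,j)` with `i < k` and its own column `j ≥ k` may be replaced by the average
degree at `i` in correlations with functionals invariant under permutations of `{k, k + 1, …}`. -/
theorem integral_mul_prod_DX {Ω : Type*} [MeasurableSpace Ω] {μ : Measure Ω} [IsFiniteMeasure μ]
    {X : Ω → ℕ → ℕ → ℕ} (hX : Measurable X) {m : ℕ} (hbdd : ∀ ω i j, X ω i j ≤ m)
    (hswap : ∀ a b, ∀ f : (ℕ → ℕ → ℕ) → ℝ, Measurable f →
      ∫ ω, f (swapIndices a b (X ω)) ∂μ = ∫ ω, f (X ω) ∂μ)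
    {k : ℕ} (S : Finset (Σ _ : Fin k, ℕ)) (hinj : Set.InjOn Sigma.snd (S : Set (Σ _ : Fin k, ℕ)))
    (hS : ∀ p ∈ S, k ≤ p.2) {B : (ℕ → ℕ → ℕ) → ℝ} (hB : Measurable B)
    (hBC : ∃ C, ∀ x ∈ {x : ℕ → ℕ → ℕ | ∀ i j, x i j ≤ m}, |B x| ≤ C)
    (hBswap : ∀ a b x, k ≤ a → k ≤ b → B (swapIndices a b x) = B x) :
    ∫ ω, B (X ω) * ∏ p ∈ S, DX (X ω) p.1 ∂μ =
      ∫ ω, B (X ω) * ∏ p ∈ S, (X ω p.1 p.2 : ℝ) ∂μ := by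
  classical
  induction S using Finset.induction_on generalizing B with
  | empty => simp
  | insert p S hp ih =>
    have hkp : k ≤ p.2 := hS p (mem_insert_self _ _)
    have hS' : ∀ q ∈ S, k ≤ q.2 := fun q hq => hS q (mem_insert_of_mem hq)
    have hpq : ∀ q ∈ S, q.2 ≠ p.2 := fun q hq h => hp
      (hinj (mem_coe.2 (mem_insert_of_mem hq)) (mem_coe.2 (mem_insert_self _ _)) h ▸ hq)
    set A : (ℕ → ℕ → ℕ) → ℝ := fun x => B x * ∏ q ∈ S, (x q.1 q.2 : ℝ) with hA
    have hAmeas : Measurable A :=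
      hB.mul (Finset.measurable_prod _ fun q _ => measurable_entry q.1 q.2)
    obtain ⟨C, hC⟩ : ∃ C, ∀ x ∈ {x : ℕ → ℕ → ℕ | ∀ i j, x i j ≤ m}, |A x| ≤ C :=
      exists_abs_mul_le hBC (exists_abs_prod_le _ _ fun q _ => ⟨m, fun x hx => by
        rw [Nat.abs_cast]; exact_mod_cast hx _ _⟩)
    have hconst : ∀ᶠ j in atTop,
        ∫ ω, A (X ω) * X ω p.1 j ∂μ = ∫ ω, A (X ω) * X ω p.1 p.2 ∂μ := by
      filter_upwards [eventually_ge_atTop k,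
        eventually_gt_atTop (S.sup Sigma.snd)] with j hj hjS
      rw [← hswap p.2 j (fun x => A x * x p.1 p.2) (hAmeas.mul (measurable_entry _ _))]
      refine integral_congr_ae (ae_of_all _ fun ω => ?_)
      have hfix : ∀ i : Fin k, Equiv.swap p.2 j i = i := fun i =>
        Equiv.swap_apply_of_ne_of_ne (by have := i.2; omega) (by have := i.2; omega)
      have hAx : A (swapIndices p.2 j (X ω)) = A (X ω) := by
        simp only [hA]
        rw [hBswap _ _ _ hkp hj]
        congr 1
        refine prod_congr rfl fun q hq => ?_
        have hqj : q.2 ≠ j := ((Finset.le_sup (f := Sigma.snd) hq).trans_lt hjS).ne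
        simp only [swapIndices, hfix, Equiv.swap_apply_of_ne_of_ne (hpq q hq) hqj]
      simp only [hAx]
      simp only [swapIndices, hfix, Equiv.swap_apply_left]
    have hstep := integral_mul_DX hX hbdd (ae_tendsto_average_DX hX hbdd hswap p.1)
      (hAmeas.comp hX) (C := C) (fun ω => hC _ (hbdd ω)) hconst
    have hrec := ih (hinj.mono (by simp)) hS' (B := fun x => B x * DX x p.1)
      (hB.mul (measurable_DX _))
      (exists_abs_mul_le hBC ⟨m, fun x hx => abs_DX_le hx _⟩)
      (fun a b x ha hb => by
        have := p.1.2
        rw [hBswap a b x ha hb, DX_swapIndices x (by omega) (by omega)])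
    simp only [prod_insert hp]
    calc _ = ∫ ω, B (X ω) * DX (X ω) p.1 * ∏ q ∈ S, DX (X ω) q.1 ∂μ := by
          simp only [mul_assoc]
      _ = ∫ ω, A (X ω) * DX (X ω) p.1 ∂μ := by
          rw [hrec]
          simp only [hA, mul_assoc, mul_comm (DX _ _)]
      _ = _ := by
          refine hstep.trans (integral_congr_ae (ae_of_all _ fun ω => ?_))
          simp only [hA]
          ring

/-- Let `X` be an infinite vertex exchangeable random array with all
entries bounded by `m`.  Then for all exponents `μ_{i,j}` (`i ≤ j` in `[k]`) and `ν_i`,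
and pairwise disjoint finite sets `J(1),…,J(k) ⊆ ℕ∖[k]` with `|J(i)| = ν_i`:
`E[∏_{i≤j} X(i,j)^{μ_{i,j}} · ∏_i D(X,i)^{ν_i}]
  = E[∏_{i≤j} X(i,j)^{μ_{i,j}} · ∏_i ∏_{j∈J(i)} X(i,j)]`. -/
theorem moments_of_average_degrees
    (Ω : Type*) [MeasurableSpace Ω] (μ : Measure Ω) [IsProbabilityMeasure μ]
    (X : Ω → ℕ → ℕ → ℕ) (hXmeas : Measurable X)
    (hsym : ∀ ω i j, X ω i j = X ω j i) (heven : ∀ ω i, 2 ∣ X ω i i)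
    (m : ℕ) (hbdd : ∀ ω i j, X ω i j ≤ m)
    (hexch : ∀ τ : Equiv.Perm ℕ, {i | τ i ≠ i}.Finite →
      Measure.map (fun ω => fun i j => X ω (τ i) (τ j)) μ = Measure.map X μ)
    (k : ℕ) (μexp : Fin k → Fin k → ℕ) (ν : Fin k → ℕ)
    (J : Fin k → Finset ℕ)
    (hJcard : ∀ i, (J i).card = ν i)
    (hJdisj : ∀ i i', i ≠ i' → Disjoint (J i) (J i'))
    (hJout : ∀ i, ∀ j ∈ J i, k ≤ j) :
    ∫ ω, (∏ i : Fin k, ∏ j : Fin k,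
            if i ≤ j then (X ω i j : ℝ) ^ (μexp i j) else 1) *
          ∏ i : Fin k, (DX (X ω) i) ^ (ν i) ∂ μ =
    ∫ ω, (∏ i : Fin k, ∏ j : Fin k,
            if i ≤ j then (X ω i j : ℝ) ^ (μexp i j) else 1) *
          ∏ i : Fin k, ∏ j ∈ J i, (X ω i j : ℝ) ∂ μ := by
  have hswap : ∀ a b, ∀ f : (ℕ → ℕ → ℕ) → ℝ, Measurable f →
      ∫ ω, f (swapIndices a b (X ω)) ∂μ = ∫ ω, f (X ω) ∂μ := by
    intro a b f hf
    rw [← integral_map hXmeas.aemeasurable hf.aestronglyMeasurable,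
      ← hexch (Equiv.swap a b) (finite_swap_support a b)]
    exact (integral_map ((measurable_swapIndices a b).comp hXmeas).aemeasurable
      hf.aestronglyMeasurable).symm
  have hinj : Set.InjOn Sigma.snd
      ((univ.sigma J : Finset (Σ _ : Fin k, ℕ)) : Set (Σ _ : Fin k, ℕ)) := by
    rintro ⟨i, a⟩ hia ⟨j, b⟩ hjb (rfl : a = b)
    simp only [mem_coe, mem_sigma, mem_univ, true_and] at hia hjb
    obtain rfl : i = j := by
      by_contra hij
      exact disjoint_left.1 (hJdisj i j hij) hia hjb
    rfl
  have hmain := integral_mul_prod_DX hXmeas hbdd hswap (univ.sigma J) hinj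
    (fun p hp => hJout p.1 p.2 (mem_sigma.1 hp).2)
    (B := fun x => ∏ i : Fin k, ∏ j : Fin k, if i ≤ j then (x i j : ℝ) ^ (μexp i j) else 1)
    (Finset.measurable_prod _ fun i _ => Finset.measurable_prod _ fun j _ => by
      split_ifs
      · exact (measurable_entry _ _).pow_const _
      · exact measurable_const)
    (exists_abs_prod_le _ _ fun i _ => exists_abs_prod_le _ _ fun j _ => by
      split_ifs
      · refine ⟨(m : ℝ) ^ μexp i j, fun x hx => ?_⟩
        rw [abs_pow, Nat.abs_cast]
        exact pow_le_pow_left₀ (Nat.cast_nonneg _) (by exact_mod_cast hx _ _) _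
      · exact ⟨1, fun x _ => by simp⟩)
    (fun a b x ha hb => by
      have hfix : ∀ i : Fin k, Equiv.swap a b i = i := fun i =>
        Equiv.swap_apply_of_ne_of_ne (by have := i.2; omega) (by have := i.2; omega)
      simp only [swapIndices, hfix])
  simpa only [prod_sigma, prod_const, hJcard] using hmain
end
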